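/- Let F be an algebraically closed field of characteristic p ≥ 5 and n ≥ 1. Then the second Chevalley–Eilenberg cohomology of the Witt–Jacobson algebra W(n) with adjoint coefficients is H^2(W(n), W(n)) = ⊕_{i=1}^n F·Sq(D_i); in particular its dimension is n, and the classes Sq(D_1),…,Sq(D_n) are linearly independent in H^2(W(n), W(n)). -/

import Mathlib

/-!
STATEMENT 12: for an algebraically closed field `F` of characteristic `p ≥ 5` and
`n ≥ 1`, `H²(W(n), W(n)) = ⊕_{i=1}^n F·Sq(D_i)`: the classes `Sq(D_i)` are cocycles
which are linearly independent in `H²` and span it (every `2`-cocycle differs from a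
unique linear combination of the `Sq(D_i)` by a coboundary).
-/

set_option maxHeartbeats 1000000
set_option synthInstance.maxHeartbeats 400000

noncomputable section

def truncIdeal (F : Type*) [Field F] (p n : ℕ) : Ideal (MvPolynomial (Fin n) F) :=
  Ideal.span (Set.range fun i : Fin n => MvPolynomial.X i ^ p)

/-- `A(n) = F[x₁,…,xₙ]/(x₁^p,…,xₙ^p)`. -/
abbrev TruncPoly (F : Type*) [Field F] (p n : ℕ) :=
  MvPolynomial (Fin n) F ⧸ truncIdeal F p n

/-- `W(n) = Der_F (A(n))`. -/
abbrev WittJacobson (F : Type*) [Field F] (p n : ℕ) :=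
  Derivation F (TruncPoly F p n) (TruncPoly F p n)

def xcl (F : Type*) [Field F] (p n : ℕ) (i : Fin n) : TruncPoly F p n :=
  Ideal.Quotient.mk _ (MvPolynomial.X i)

/-- `2`-cocycles for the adjoint representation. -/
def IsLieCocycle2 (F : Type*) {L : Type*} [Field F] [LieRing L] [LieAlgebra F L]
    (c : L → L → L) : Prop :=
  (∀ (t : F) (x x' y : L), c (t • x + x') y = t • c x y + c x' y) ∧
  (∀ (t : F) (x y y' : L), c x (t • y + y') = t • c x y + c x y') ∧
  (∀ x : L, c x x = 0) ∧
  (∀ x y z : L,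
    ⁅x, c y z⁆ + ⁅y, c z x⁆ + ⁅z, c x y⁆ +
      c x ⁅y, z⁆ + c y ⁅z, x⁆ + c z ⁅x, y⁆ = 0)

/-- `2`-coboundaries for the adjoint representation. -/
def IsLieCoboundary2 (F : Type*) {L : Type*} [Field F] [LieRing L] [LieAlgebra F L]
    (c : L → L → L) : Prop :=
  ∃ g : L →ₗ[F] L, ∀ x y : L, c x y = ⁅x, g y⁆ - ⁅y, g x⁆ - g ⁅x, y⁆

/-- The squaring `Sq(D)(x,y) = ∑_{i=1}^{p-1} (i!(p-i)!)⁻¹ • ⁅Dⁱ x, D^{p-i} y⁆`. -/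
def sqCochain (F : Type*) {L : Type*} [Field F] [LieRing L]
    [LieAlgebra F L] (p : ℕ) (D : L → L) : L → L → L :=
  fun x y => ∑ i ∈ Finset.Icc 1 (p - 1),
    (((Nat.factorial i * Nat.factorial (p - i) : ℕ) : F))⁻¹ • ⁅D^[i] x, D^[p - i] y⁆

section Squaring

variable {F L : Type*} [Field F] [LieRing L] [LieAlgebra F L]

open Finset

/-- The divided power `Dⁱ / i!` for `i < p`, and `0` for `i ≥ p`. -/
def divPow (F : Type*) {L : Type*} [Field F] [LieRing L] [LieAlgebra F L] (p : ℕ)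
    (D : LieDerivation F L L) (i : ℕ) (x : L) : L :=
  if i < p then ((i.factorial : F))⁻¹ • D^[i] x else 0

lemma factorial_cast_ne_zero (F : Type*) [Field F] (p : ℕ) [CharP F p] (hp : p.Prime) {m : ℕ}
    (hm : m < p) : (m.factorial : F) ≠ 0 := by
  rw [Ne, CharP.cast_eq_zero_iff F p, hp.dvd_factorial]
  omega

lemma divPow_lie (p : ℕ) [CharP F p] (hp : p.Prime) (D : LieDerivation F L L) {m : ℕ}
    (hm : m < p) (x y : L) :
    divPow F p D m ⁅x, y⁆ =
      ∑ ij ∈ antidiagonal m, ⁅divPow F p D ij.1 x, divPow F p D ij.2 y⁆ := by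
  rw [divPow, if_pos hm, LieDerivation.iterate_apply_lie, smul_sum]
  refine sum_congr rfl fun ij h => ?_
  rw [HasAntidiagonal.mem_antidiagonal] at h
  have h1 : ij.1 < p := by omega
  have h2 : ij.2 < p := by omega
  have hc : (m.choose ij.1 : F) * (ij.1.factorial * ij.2.factorial) = m.factorial := by
    rw [← h, ← mul_assoc]
    rw [← Nat.cast_mul, ← Nat.cast_mul, ← Nat.add_choose_mul_factorial_mul_factorial,
      Nat.choose_symm_add]
  rw [divPow, divPow, if_pos h1, if_pos h2, smul_lie, lie_smul, smul_smul, ← Nat.cast_smul_eq_nsmul F,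
    smul_smul]
  congr 1
  have f0 := factorial_cast_ne_zero F p hp hm
  have f1 := factorial_cast_ne_zero F p hp h1
  have f2 := factorial_cast_ne_zero F p hp h2
  field_simp
  rw [← hc]; ring

lemma sqCochain_eq_divPow (p : ℕ) (hp : p.Prime) (D : LieDerivation F L L) (x y : L) :
    sqCochain F p D x y =
      ∑ ij ∈ antidiagonal p, ⁅divPow F p D ij.1 x, divPow F p D ij.2 y⁆ := by
  have hp0 := hp.pos
  rw [Nat.sum_antidiagonal_eq_sum_range_succ_mk, sum_range_succ, sum_range_eq_add_Ico _ hp0]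
  simp only [divPow, lt_irrefl, if_false, zero_lie, Nat.sub_zero, lie_zero, zero_add, add_zero]
  rw [sqCochain]
  refine sum_congr (by ext; simp; omega) fun i hi => ?_
  rw [mem_Ico] at hi
  rw [if_pos hi.2, if_pos (by omega), smul_lie, lie_smul, smul_smul, Nat.cast_mul, mul_inv]

/-- Sum over all triples of natural numbers with sum `p`. -/
def tripleSum {M : Type*} [AddCommMonoid M] (p : ℕ) (f : ℕ → ℕ → ℕ → M) : M :=
  ∑ i ∈ range (p + 1), ∑ j ∈ range (p + 1), ∑ k ∈ range (p + 1),
    if i + j + k = p then f i j k else 0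

lemma tripleSum_rotate {M : Type*} [AddCommMonoid M] (p : ℕ) (f : ℕ → ℕ → ℕ → M) :
    tripleSum p (fun i j k => f j k i) = tripleSum p f := by
  unfold tripleSum
  rw [sum_comm]
  refine sum_congr rfl fun i _ => ?_
  rw [sum_comm]
  refine sum_congr rfl fun j _ => sum_congr rfl fun k _ => ?_
  rw [show k + i + j = i + j + k by ring]

lemma tripleSum_eq_antidiagonal {M : Type*} [AddCommMonoid M] (p : ℕ) (f : ℕ → ℕ → ℕ → M) :
    tripleSum p f = ∑ ij ∈ antidiagonal p, ∑ kl ∈ antidiagonal ij.2, f ij.1 kl.1 kl.2 := by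
  unfold tripleSum
  rw [Nat.sum_antidiagonal_eq_sum_range_succ_mk]
  refine sum_congr rfl fun i hi => ?_
  rw [mem_range] at hi
  rw [Nat.sum_antidiagonal_eq_sum_range_succ_mk,
    ← sum_subset (s₁ := range (p - i).succ) (range_subset_range.2 (by omega))]
  · refine sum_congr rfl fun j hj => ?_
    rw [mem_range] at hj
    rw [sum_eq_single (p - i - j)]
    · rw [if_pos (by omega)]
    · intro k _ hk
      rw [if_neg (by omega)]
    · intro h
      rw [mem_range] at h
      omega
  · intro j _ hj
    rw [mem_range] at hj
    exact sum_eq_zero fun k _ => if_neg (by omega)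

lemma tripleSum_divPow (p : ℕ) [CharP F p] (hp : p.Prime) (D : LieDerivation F L L) (x y z : L) :
    tripleSum p (fun i j k => ⁅divPow F p D i x, ⁅divPow F p D j y, divPow F p D k z⁆⁆) =
      ⁅x, sqCochain F p D y z⁆ + sqCochain F p D x ⁅y, z⁆ := by
  have key : ∀ ij ∈ antidiagonal p, ∑ kl ∈ antidiagonal ij.2,
      ⁅divPow F p D ij.1 x, ⁅divPow F p D kl.1 y, divPow F p D kl.2 z⁆⁆ =
        (if ij = (0, p) then ⁅x, sqCochain F p D y z⁆ else 0) +
          ⁅divPow F p D ij.1 x, divPow F p D ij.2 ⁅y, z⁆⁆ := by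
    rintro ⟨i, j⟩ h
    rw [HasAntidiagonal.mem_antidiagonal] at h
    dsimp only at h ⊢
    rw [← lie_sum]
    split_ifs with hij
    · rw [Prod.mk.injEq] at hij
      obtain ⟨rfl, rfl⟩ := hij
      simp [divPow, hp.pos, sqCochain_eq_divPow _ hp]
    · have hj : j < p := by
        rw [Prod.mk.injEq] at hij
        omega
      rw [divPow_lie p hp D hj, zero_add]
  rw [tripleSum_eq_antidiagonal, sqCochain_eq_divPow p hp D x, sum_congr rfl key, sum_add_distrib,
    sum_ite_eq', if_pos (by simp)]

lemma sqCochain_self (p : ℕ) (hp : p.Prime) (hp2 : (2 : F) ≠ 0) (D : LieDerivation F L L) (x : L) :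
    sqCochain F p D x x = 0 := by
  rw [sqCochain_eq_divPow p hp]
  set S := ∑ ij ∈ antidiagonal p, ⁅divPow F p D ij.1 x, divPow F p D ij.2 x⁆ with hS
  have h : S = -S := by
    conv_lhs => rw [hS, ← Nat.sum_antidiagonal_swap]
    rw [hS, ← sum_neg_distrib]
    exact sum_congr rfl fun ij _ => (lie_skew _ _).symm
  have h2 : (2 : F) • S = 0 := by rw [two_smul]; nth_rewrite 1 [h]; exact neg_add_cancel S
  exact (smul_eq_zero.1 h2).resolve_left hp2

/-- The squaring of a derivation is a `2`-cocycle. -/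
lemma isLieCocycle2_sqCochain (p : ℕ) [CharP F p] (hp : p.Prime) (hp2 : (2 : F) ≠ 0)
    (D : LieDerivation F L L) : IsLieCocycle2 F (sqCochain F p D) := by
  have hit : ∀ i (t : F) (x x' : L), D^[i] (t • x + x') = t • D^[i] x + D^[i] x' := by
    intro i t
    induction i with
    | zero => intro x x'; rfl
    | succ i ih => intro x x'; simp only [Function.iterate_succ_apply, map_add, map_smul, ih]
  refine ⟨?_, ?_, sqCochain_self p hp hp2 D, ?_⟩
  · intro t x x' y
    simp only [sqCochain, hit, add_lie, smul_lie, smul_add, sum_add_distrib, smul_sum]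
    congr 1
    exact sum_congr rfl fun i _ => smul_comm _ _ _
  · intro t x y y'
    simp only [sqCochain, hit, lie_add, lie_smul, smul_add, sum_add_distrib, smul_sum]
    congr 1
    exact sum_congr rfl fun i _ => smul_comm _ _ _
  · intro x y z
    have h1 := tripleSum_divPow p hp D x y z
    have h2 := tripleSum_divPow p hp D y z x
    have h3 := tripleSum_divPow p hp D z x y
    rw [← tripleSum_rotate] at h1
    rw [← tripleSum_rotate, ← tripleSum_rotate] at h2
    have h : tripleSum p (fun i j k => ⁅divPow F p D j x, ⁅divPow F p D k y, divPow F p D i z⁆⁆) +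
        tripleSum p (fun i j k => ⁅divPow F p D k y, ⁅divPow F p D i z, divPow F p D j x⁆⁆) +
        tripleSum p (fun i j k => ⁅divPow F p D i z, ⁅divPow F p D j x, divPow F p D k y⁆⁆) = 0 := by
      simp only [tripleSum, ← sum_add_distrib]
      refine sum_eq_zero fun i _ => sum_eq_zero fun j _ => sum_eq_zero fun k _ => ?_
      split_ifs
      · exact lie_jacobi _ _ _
      · simp
    rw [h1, h2, h3] at h
    rw [← h]
    abel

end Squaring

section Weyl

variable {F M : Type*} [Field F] [AddCommGroup M] [Module F M]

open Finset

lemma sub_pow_char_end (p : ℕ) [CharP F p] (hp : p.Prime) (A B : Module.End F M)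
    (h : Commute A B) : (A - B) ^ p = A ^ p - B ^ p := by
  have := Fact.mk hp
  rcases subsingleton_or_nontrivial M with hM | hM
  · exact LinearMap.ext fun x => Subsingleton.elim _ _
  · have : CharP (Module.End F M) p :=
      charP_of_injective_algebraMap (FaithfulSMul.algebraMap_injective F (Module.End F M)) p
    exact sub_pow_char_of_commute p h

lemma weyl_pow (N X : Module.End F M) (h : ∀ m, N (X m) = X (N m) + m) (k : ℕ) (m : M) :
    N ((X ^ k) m) = (X ^ k) (N m) + (k : F) • (X ^ (k - 1)) m := by
  induction k with
  | zero => simp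
  | succ k ih =>
    rw [pow_succ', Module.End.mul_apply, h, ih, map_add, map_smul, ← Module.End.mul_apply,
      ← pow_succ', Nat.add_sub_cancel, add_assoc, Nat.cast_succ, add_smul, one_smul]
    congr 2
    rcases k with _ | k
    · simp
    · rw [Nat.add_sub_cancel, ← Module.End.mul_apply, ← pow_succ']

/-- The Poincaré homotopy `∑_{k<p-1} (-1)^k/(k+1)! X^{k+1} N^k` of a Weyl pair `N, X`. -/
def poincare (p : ℕ) (N X : Module.End F M) : Module.End F M :=
  ∑ k ∈ range (p - 1), ((-1) ^ k * ((k + 1).factorial : F)⁻¹) • (X ^ (k + 1) * N ^ k)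

/-- The projection `∑_{k<p} (-1)^k/k! X^k N^k` onto the kernel of `N`. -/
def weylProj (p : ℕ) (N X : Module.End F M) : Module.End F M :=
  ∑ k ∈ range p, ((-1) ^ k * (k.factorial : F)⁻¹) • (X ^ k * N ^ k)

lemma poincare_apply_apply (p : ℕ) (hp : 0 < p) (N X : Module.End F M) (m : M) :
    poincare p N X (N m) = m - weylProj p N X m := by
  obtain ⟨q, rfl⟩ : ∃ q, p = q + 1 := ⟨p - 1, by omega⟩
  rw [weylProj, sum_range_succ', poincare, Nat.add_sub_cancel]
  simp only [LinearMap.add_apply, LinearMap.sum_apply, LinearMap.smul_apply, Module.End.mul_apply,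
    pow_succ (-1 : F), pow_succ N, pow_zero, Nat.factorial_zero, Nat.cast_one, inv_one, one_smul,
    mul_one, Module.End.one_apply, mul_neg, neg_mul, neg_smul, sum_neg_distrib]
  rw [sub_add_cancel_right, LinearMap.neg_apply, neg_neg, LinearMap.sum_apply]
  rfl

lemma apply_poincare (p : ℕ) [CharP F p] (N X : Module.End F M)
    (h : ∀ m, N (X m) = X (N m) + m) (m : M) (hm : (N ^ (p - 1)) m = 0) :
    N (poincare p N X m) = m := by
  set u : ℕ → M := fun k => ((-1) ^ k * (k.factorial : F)⁻¹) • (X ^ k) ((N ^ k) m) with hu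
  have key : ∀ k ∈ range (p - 1), N ((((-1) ^ k * ((k + 1).factorial : F)⁻¹) •
      (X ^ (k + 1) * N ^ k)) m) = u k - u (k + 1) := by
    intro k hk
    rw [mem_range] at hk
    have hk1 : ((k + 1 : ℕ) : F) ≠ 0 := by
      rw [Ne, CharP.cast_eq_zero_iff F p]
      exact fun hd => absurd (Nat.le_of_dvd (Nat.succ_pos k) hd) (by omega)
    rw [LinearMap.smul_apply, map_smul, Module.End.mul_apply, weyl_pow N X h, smul_add, smul_smul,
      Nat.add_sub_cancel, ← Module.End.mul_apply N, ← pow_succ', hu]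
    have e1 : ((-1 : F) ^ k * ((k + 1).factorial : F)⁻¹) * ((k + 1 : ℕ) : F) =
        (-1) ^ k * (k.factorial : F)⁻¹ := by
      rw [Nat.factorial_succ, Nat.cast_mul, mul_inv]
      field_simp
    dsimp only
    rw [e1, pow_succ (-1 : F), mul_neg_one, neg_mul, neg_smul, sub_neg_eq_add, add_comm]
  rw [poincare, LinearMap.sum_apply, map_sum, sum_congr rfl key, sum_range_sub']
  simp [hu, hm]

lemma commute_poincare (p : ℕ) (N X T : Module.End F M) (hN : Commute T N) (hX : Commute T X) :
    Commute T (poincare p N X) := by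
  refine Commute.sum_right _ _ _ fun k _ => Commute.smul_right ?_ _
  exact (hX.pow_right _).mul_right (hN.pow_right _)

end Weyl

section Cochains

variable {F L : Type*} [Field F] [LieRing L] [LieAlgebra F L]

lemma lie_bilin_apply (h : L) (c : L →ₗ[F] L →ₗ[F] L) (x y : L) :
    ⁅h, c⁆ x y = ⁅h, c x y⁆ - c x ⁅h, y⁆ - c ⁅h, x⁆ y := by
  simp [LieHom.lie_apply]

/-- Coboundary of a `1`-cochain. -/
def dOne (g : L →ₗ[F] L) : L →ₗ[F] L →ₗ[F] L :=
  LinearMap.mk₂ F (fun x y => ⁅x, g y⁆ - ⁅y, g x⁆ - g ⁅x, y⁆)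
    (fun x x' y => by simp only [add_lie, map_add, lie_add]; abel)
    (fun t x y => by simp only [smul_lie, map_smul, lie_smul, smul_sub])
    (fun x x' y => by simp only [add_lie, map_add, lie_add]; abel)
    (fun t x y => by simp only [smul_lie, map_smul, lie_smul, smul_sub])

@[simp] lemma dOne_apply (g : L →ₗ[F] L) (x y : L) :
    dOne g x y = ⁅x, g y⁆ - ⁅y, g x⁆ - g ⁅x, y⁆ := rfl

lemma dOne_add (f g : L →ₗ[F] L) : dOne (f + g) = dOne f + dOne g := by
  ext x y
  simp only [dOne_apply, LinearMap.add_apply, lie_add]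
  abel

/-- Bilinear `2`-cocycles with adjoint coefficients. -/
structure IsCoc (c : L →ₗ[F] L →ₗ[F] L) : Prop where
  alt : ∀ x, c x x = 0
  jac : ∀ x y z : L, ⁅x, c y z⁆ + ⁅y, c z x⁆ + ⁅z, c x y⁆ +
      c x ⁅y, z⁆ + c y ⁅z, x⁆ + c z ⁅x, y⁆ = 0

namespace IsCoc

variable {c c' : L →ₗ[F] L →ₗ[F] L}

lemma swap (hc : IsCoc c) (x y : L) : c x y = -c y x := by
  have h := hc.alt (x + y)
  simp only [map_add, LinearMap.add_apply, hc.alt, zero_add, add_zero] at h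
  exact eq_neg_of_add_eq_zero_right h

lemma add (hc : IsCoc c) (hc' : IsCoc c') : IsCoc (c + c') where
  alt x := by simp [hc.alt, hc'.alt]
  jac x y z := by
    have := congrArg₂ (· + ·) (hc.jac x y z) (hc'.jac x y z)
    simp only [add_zero] at this
    simp only [LinearMap.add_apply, lie_add]
    rw [← this]; abel

lemma neg (hc : IsCoc c) : IsCoc (-c) where
  alt x := by simp [hc.alt]
  jac x y z := by
    have := congrArg (- ·) (hc.jac x y z)
    simp only [neg_zero] at this
    simp only [LinearMap.neg_apply, lie_neg]
    rw [← this]; abel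

lemma sub (hc : IsCoc c) (hc' : IsCoc c') : IsCoc (c - c') := by
  rw [sub_eq_add_neg]; exact hc.add hc'.neg

lemma dOne (g : L →ₗ[F] L) : IsCoc (dOne g) where
  alt x := by simp
  jac x y z := by
    simp only [dOne_apply, lie_sub]
    have h1 := congrArg g (lie_jacobi x y z)
    simp only [map_add, map_zero] at h1
    rw [lie_lie y z, lie_lie z x, lie_lie x y]
    rw [← sub_eq_zero, sub_zero, ← neg_eq_zero, ← h1]
    abel

lemma lie_eq (hc : IsCoc c) (h : L) : ⁅h, c⁆ = _root_.dOne (c h) := by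
  ext x y
  have := hc.jac h x y
  rw [lie_bilin_apply, dOne_apply]
  rw [hc.swap y h, hc.swap y, ← lie_skew y h, lie_neg, map_neg] at this
  rw [← sub_eq_zero, ← this]; abel

end IsCoc

lemma lie_dOne (h : L) (g : L →ₗ[F] L) : ⁅h, dOne g⁆ = dOne ⁅h, g⁆ := by
  ext x y
  rw [lie_bilin_apply]
  simp only [dOne_apply, LieHom.lie_apply, lie_sub]
  rw [leibniz_lie h x y, map_add, leibniz_lie h x (g y), leibniz_lie h y (g x)]
  abel

end Cochains

section EndPow

variable {F L M N : Type*} [Field F] [LieRing L] [LieAlgebra F L] [AddCommGroup M] [Module F M]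
  [LieRingModule L M] [LieModule F L M] [AddCommGroup N] [Module F N]
  [LieRingModule L N] [LieModule F L N]

open LieModule

lemma toEnd_hom_pow (p : ℕ) [CharP F p] (hp : p.Prime) (h : L) (κ : F)
    (hM : toEnd F L M h ^ p = κ • toEnd F L M h) (hN : toEnd F L N h ^ p = κ • toEnd F L N h) :
    toEnd F L (M →ₗ[F] N) h ^ p = κ • toEnd F L (M →ₗ[F] N) h := by
  set A : Module.End F (M →ₗ[F] N) := LinearMap.compRight F (toEnd F L N h) with hA
  set B : Module.End F (M →ₗ[F] N) := LinearMap.lcomp F N (toEnd F L M h) with hB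
  have hAB : toEnd F L (M →ₗ[F] N) h = A - B := by
    ext f m
    simp [hA, hB]
  have hAp : ∀ k f, (A ^ k) f = (toEnd F L N h ^ k) ∘ₗ f := by
    intro k
    induction k with
    | zero => intro f; rfl
    | succ k ih => intro f; rw [pow_succ, Module.End.mul_apply, ih]; rfl
  have hBp : ∀ k f, (B ^ k) f = f ∘ₗ (toEnd F L M h ^ k) := by
    intro k
    induction k with
    | zero => intro f; rfl
    | succ k ih => intro f; rw [pow_succ, Module.End.mul_apply, ih, pow_succ']; rfl
  have hcomm : Commute A B := by
    ext f m; rfl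
  rw [hAB, sub_pow_char_end p hp A B hcomm, smul_sub]
  ext f m
  rw [LinearMap.sub_apply, hAp, hBp, hM, hN]
  simp [hA, hB]

end EndPow

section Frame

open Finset

/-- The exponent vector of the `i`-th variable. -/
def eps {n : ℕ} (i : Fin n) : Fin n → ℕ := Pi.single i 1

@[simp] lemma eps_apply {n : ℕ} (i j : Fin n) : eps i j = if j = i then 1 else 0 := by
  simp [eps, Pi.single_apply]

lemma eps_ne_zero {n : ℕ} (i : Fin n) : eps i ≠ 0 := fun h => by
  simpa using congrFun h i

/-- A Lie algebra with a spanning family `e a i`, standing for `x^a D_i`, which multiplies as in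
`W(n)`, together with evaluation of the coefficients at the origin, the multiplications by the
variables and the endomorphisms `f D_s ↦ f D_k`. -/
structure WittFrame (F : Type*) [Field F] (p n : ℕ) (L : Type*) [LieRing L] [LieAlgebra F L] where
  e : (Fin n → ℕ) → Fin n → L
  ev : Fin n → L →ₗ[F] F
  X : Fin n → Module.End F L
  R : Fin n → Fin n → Module.End F L
  span_e : Submodule.span F (Set.range fun q : (Fin n → ℕ) × Fin n => e q.1 q.2) = ⊤
  e_eq_zero : ∀ a i t, p ≤ a t → e a i = 0
  ev_e : ∀ k a i, ev k (e a i) = if a = 0 ∧ i = k then 1 else 0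
  X_e : ∀ t a i, X t (e a i) = e (a + eps t) i
  R_e : ∀ s k a i, R s k (e a i) = if i = s then e a k else 0
  lie_e : ∀ a b i j, ⁅e a i, e b j⁆ =
    (b i : F) • e (a + b - eps i) j - (a j : F) • e (a + b - eps j) i

namespace WittFrame

variable {F : Type*} [Field F] {p n : ℕ} {L : Type*} [LieRing L] [LieAlgebra F L]
  (W : WittFrame F p n L)

/-- The derivation `∂/∂x_j`. -/
def D (j : Fin n) : L := W.e 0 j

/-- The toral element `x_t ∂/∂x_t`. -/
def h (t : Fin n) : L := W.e (eps t) t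

/-- The inner derivation `ad D_j`. -/
def dd (j : Fin n) : Module.End F L := LieAlgebra.ad F L (W.D j)

@[simp] lemma dd_apply (j : Fin n) (y : L) : W.dd j y = ⁅W.D j, y⁆ := rfl

lemma hom_ext {M : Type*} [AddCommGroup M] [Module F M] {f g : L →ₗ[F] M}
    (H : ∀ a i, (∀ t, a t < p) → f (W.e a i) = g (W.e a i)) : f = g := by
  refine LinearMap.ext_on W.span_e ?_
  rintro _ ⟨⟨a, i⟩, rfl⟩
  by_cases ha : ∀ t, a t < p
  · exact H a i ha
  · push Not at ha
    obtain ⟨t, ht⟩ := ha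
    simp only [W.e_eq_zero a i t ht, map_zero]

lemma lie_e_of_eq {a b : Fin n → ℕ} {i j : Fin n} (u v : Fin n → ℕ)
    (hu : b i ≠ 0 → ∀ t, u t + eps i t = a t + b t)
    (hv : a j ≠ 0 → ∀ t, v t + eps j t = a t + b t) :
    ⁅W.e a i, W.e b j⁆ = (b i : F) • W.e u j - (a j : F) • W.e v i := by
  rw [W.lie_e]
  congr 1
  · by_cases hb : b i = 0
    · simp [hb]
    · congr 2
      ext t
      simp only [Pi.sub_apply, Pi.add_apply, ← hu hb t, Nat.add_sub_cancel]
  · by_cases hb : a j = 0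
    · simp [hb]
    · congr 2
      ext t
      simp only [Pi.sub_apply, Pi.add_apply, ← hv hb t, Nat.add_sub_cancel]

lemma lie_D_e (j : Fin n) (b : Fin n → ℕ) (i : Fin n) :
    ⁅W.D j, W.e b i⁆ = (b j : F) • W.e (b - eps j) i := by
  simp [D, W.lie_e]

lemma lie_h_e (t : Fin n) (b : Fin n → ℕ) (j : Fin n) :
    ⁅W.h t, W.e b j⁆ = ((b t : F) - if j = t then 1 else 0) • W.e b j := by
  have := W.lie_e_of_eq (a := eps t) (b := b) (i := t) (j := j) b b (fun _ s => add_comm _ _)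
    (fun h s => by
      have : j = t := by by_contra h1; simp [h1] at h
      subst this
      exact add_comm _ _)
  rw [h, this]
  by_cases hj : j = t
  · subst hj; simp [sub_smul]
  · simp [hj]

lemma X_pow_e (t : Fin n) (k : ℕ) (a : Fin n → ℕ) (i : Fin n) :
    (W.X t ^ k) (W.e a i) = W.e (a + k • eps t) i := by
  induction k generalizing a with
  | zero => simp
  | succ k ih =>
    rw [pow_succ, Module.End.mul_apply, W.X_e, ih]
    congr 1
    rw [succ_nsmul]; abel

lemma dd_pow_e (j : Fin n) (k : ℕ) (b : Fin n → ℕ) (i : Fin n) :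
    (W.dd j ^ k) (W.e b i) = ((b j).descFactorial k : F) • W.e (b - k • eps j) i := by
  induction k with
  | zero => simp
  | succ k ih =>
    rw [pow_succ', Module.End.mul_apply, ih, map_smul, dd_apply, lie_D_e, smul_smul,
      Nat.descFactorial_succ, succ_nsmul, Nat.cast_mul, mul_comm]
    congr 2
    · simp
    · rw [tsub_tsub]

lemma dd_pow_p [CharP F p] (j : Fin n) : W.dd j ^ p = 0 := by
  refine W.hom_ext fun a i ha => ?_
  rw [dd_pow_e, Nat.descFactorial_of_lt (ha j)]
  simp

lemma ad_h_pow [CharP F p] (hp : p.Prime) (t : Fin n) :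
    LieAlgebra.ad F L (W.h t) ^ p = LieAlgebra.ad F L (W.h t) := by
  have := Fact.mk hp
  refine W.hom_ext fun a i _ => ?_
  have key : ∀ k, (LieAlgebra.ad F L (W.h t) ^ k) (W.e a i) =
      ((a t : F) - if i = t then 1 else 0) ^ k • W.e a i := by
    intro k
    induction k with
    | zero => simp
    | succ k ih =>
      rw [pow_succ', Module.End.mul_apply, ih, map_smul, LieAlgebra.ad_apply, lie_h_e, smul_smul,
        pow_succ]
  rw [key, LieAlgebra.ad_apply, lie_h_e, sub_pow_char, ← frobenius_def, map_natCast]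
  split_ifs <;> simp [hp.ne_zero]

lemma lie_D_X (i j : Fin n) (y : L) :
    ⁅W.D i, W.X j y⁆ = W.X j ⁅W.D i, y⁆ + if i = j then y else 0 := by
  have : W.dd i ∘ₗ W.X j = W.X j ∘ₗ W.dd i + if i = j then LinearMap.id else 0 := by
    refine W.hom_ext fun a k _ => ?_
    simp only [LinearMap.comp_apply, LinearMap.add_apply, W.X_e, dd_apply, lie_D_e, map_smul]
    split_ifs with h
    · subst h
      by_cases ha : a i = 0
      · simp [ha]
      · have : a - eps i + eps i = a := by
          ext t; simp; split_ifs with h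
          · subst h; omega
          · rfl
        simp [this, add_smul]
    · by_cases ha : a i = 0
      · simp [ha, h]
      · have : a + eps j - eps i = a - eps i + eps j := by
          ext t; simp; split_ifs with h
          all_goals omega
        simp [this, h]
  have := LinearMap.congr_fun this y
  simp only [LinearMap.comp_apply, LinearMap.add_apply, dd_apply] at this
  rw [this]
  split_ifs <;> rfl

lemma weylProj_e [CharP F p] (hp : p.Prime) (j : Fin n) (a : Fin n → ℕ) (i : Fin n) :
    weylProj p (W.dd j) (W.X j) (W.e a i) = if a j = 0 then W.e a i else 0 := by
  by_cases ha : p ≤ a j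
  · simp [W.e_eq_zero a i j ha]
  push Not at ha
  have key : ∀ k ∈ range p, (((-1) ^ k * (k.factorial : F)⁻¹) •
      (W.X j ^ k * W.dd j ^ k)) (W.e a i) = (((-1) ^ k * (a j).choose k : ℤ) : F) • W.e a i := by
    intro k hk
    rw [mem_range] at hk
    rw [LinearMap.smul_apply, Module.End.mul_apply, dd_pow_e, map_smul, X_pow_e, smul_smul]
    by_cases hkj : a j < k
    · rw [Nat.descFactorial_of_lt hkj, Nat.choose_eq_zero_of_lt hkj]; simp
    · have e1 : a - k • eps j + k • eps j = a := by
        ext t; simp; split_ifs with h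
        · subst h; omega
        · rfl
      have := factorial_cast_ne_zero F p hp hk
      rw [e1, Nat.descFactorial_eq_factorial_mul_choose]
      push_cast
      congr 1
      field_simp
  rw [weylProj, LinearMap.sum_apply, sum_congr rfl key, ← sum_smul, ← Int.cast_sum,
    ← sum_subset (range_subset_range.2 (Nat.succ_le_of_lt ha)), Int.alternating_sum_range_choose]
  · split_ifs <;> simp
  · intro k _ hk
    rw [mem_range, not_lt] at hk
    rw [Nat.choose_eq_zero_of_lt (by omega)]; simp

lemma weylProj_X [CharP F p] (hp : p.Prime) (j : Fin n) (y : L) :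
    weylProj p (W.dd j) (W.X j) (W.X j y) = 0 := by
  have : weylProj p (W.dd j) (W.X j) ∘ₗ W.X j = 0 := by
    refine W.hom_ext fun a i _ => ?_
    simp [W.X_e, W.weylProj_e hp]
  exact LinearMap.congr_fun this y

lemma weylProj_of_lie_eq_zero (hp : 0 < p) (j : Fin n) (y : L) (h : ⁅W.D j, y⁆ = 0) :
    weylProj p (W.dd j) (W.X j) y = y := by
  have := poincare_apply_apply p hp (W.dd j) (W.X j) y
  rw [dd_apply, h, map_zero] at this
  exact (sub_eq_zero.1 this.symm).symm

/-- An element commuting with all `D_j` is a combination of the `D_j`. -/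
lemma eq_sum_D_of_lie_eq_zero [CharP F p] (hp : p.Prime) (y : L) (hy : ∀ j, ⁅W.D j, y⁆ = 0) :
    y = ∑ k, W.ev k y • W.D k := by
  have key : ∀ s : List (Fin n), ∀ a i,
      (s.map fun j => weylProj p (W.dd j) (W.X j)).prod (W.e a i) =
        if ∀ j ∈ s, a j = 0 then W.e a i else 0 := by
    intro s a i
    induction s with
    | nil => simp
    | cons j s ih =>
      rw [List.map_cons, List.prod_cons, Module.End.mul_apply, ih]
      split_ifs with h1 h2 h2
      · rw [W.weylProj_e hp, if_pos (h2 j (by simp))]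
      · rw [W.weylProj_e hp, if_neg]
        intro h3
        exact h2 (by simpa [h3] using h1)
      · exact absurd (fun k hk => h2 k (by simp [hk])) h1
      · simp
  have fix : ∀ s : List (Fin n), (s.map fun j => weylProj p (W.dd j) (W.X j)).prod y = y := by
    intro s
    induction s with
    | nil => simp
    | cons j s ih =>
      rw [List.map_cons, List.prod_cons, Module.End.mul_apply, ih,
        W.weylProj_of_lie_eq_zero hp.pos j y (hy j)]
  have tot : (List.map (fun j => weylProj p (W.dd j) (W.X j)) (univ : Finset (Fin n)).toList).prod =
      ∑ k, (W.ev k).smulRight (W.D k) := by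
    refine W.hom_ext fun a i _ => ?_
    rw [key, LinearMap.sum_apply]
    simp only [LinearMap.smulRight_apply, W.ev_e]
    by_cases ha : a = 0
    · subst ha
      simp [D]
    · rw [if_neg]
      · simp [ha]
      · intro h
        exact ha (funext fun j => h j (by simp))
  have := LinearMap.congr_fun tot y
  rw [fix] at this
  simpa using this

lemma eq_zero_of_lie_eq_zero [CharP F p] (hp : p.Prime) (y : L) (hy : ∀ j, ⁅W.D j, y⁆ = 0)
    (hev : ∀ k, W.ev k y = 0) : y = 0 := by
  rw [W.eq_sum_D_of_lie_eq_zero hp y hy]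
  simp [hev]

@[simp] lemma lie_D_D (i j : Fin n) : ⁅W.D i, W.D j⁆ = 0 := by
  rw [D, D, W.lie_e]; simp

end WittFrame

end Frame

lemma natCast_ne_zero_of_lt (F : Type*) [Field F] (p : ℕ) [CharP F p] {k : ℕ} (hk : k ≠ 0)
    (hkp : k < p) : (k : F) ≠ 0 := by
  rw [Ne, CharP.cast_eq_zero_iff F p]
  exact fun h => absurd (Nat.le_of_dvd (Nat.pos_of_ne_zero hk) h) (by omega)

namespace WittFrame

variable {F : Type*} [Field F] {p n : ℕ} {L : Type*} [LieRing L] [LieAlgebra F L]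
  (W : WittFrame F p n L)

section Generation

variable {W} {S : LieSubalgebra F L}

lemma mem_of_smul_mem {t : F} (ht : t ≠ 0) {x : L} (h : t • x ∈ S) : x ∈ S :=
  (S.toSubmodule.smul_mem_iff ht).1 h

variable [CharP F p]

lemma mem_pow (h1 : ∀ j i, W.e (eps j) i ∈ S)
    (h2 : ∀ i, W.e (2 • eps i) i ∈ S) (h0 : ∀ i, W.D i ∈ S) (h3 : ∀ i, W.e (3 • eps i) i ∈ S) (i : Fin n) (a : ℕ) :
    W.e (a • eps i) i ∈ S := by
  by_cases hap : p ≤ a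
  · rw [W.e_eq_zero _ i i (by simpa using hap)]; exact S.zero_mem
  induction a with
  | zero => simpa [D] using h0 i
  | succ a ih =>
    rcases a with _ | _ | _ | a
    · simpa using h1 i i
    · exact h2 i
    · exact h3 i
    · have := S.lie_mem (h2 i) (ih (by omega))
      rw [W.lie_e_of_eq ((a + 4) • eps i) ((a + 4) • eps i)
        (by intro _ t; simp; split_ifs <;> omega) (by intro _ t; simp; split_ifs <;> omega),
        ← sub_smul] at this
      refine mem_of_smul_mem (t := ((a + 1 : ℕ) : F)) (natCast_ne_zero_of_lt F p (by omega) (by omega)) ?_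
      convert this using 2
      simp
      ring

lemma mem_mul_pow (hp : 5 ≤ p) (h1 : ∀ j i, W.e (eps j) i ∈ S)
    (h2 : ∀ i, W.e (2 • eps i) i ∈ S) (h0 : ∀ i, W.D i ∈ S) (h3 : ∀ i, W.e (3 • eps i) i ∈ S) (i j : Fin n)
    (hij : j ≠ i) (s : ℕ) : W.e (eps i + s • eps j) i ∈ S := by
  have hij' := hij.symm
  have m1 : W.e (eps i + eps j) i ∈ S := by
    have := S.lie_mem (h1 j i) (h2 i)
    rw [W.lie_e_of_eq (eps i + eps j) 0 (by intro _ t; simp; split_ifs <;> omega)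
      (by intro h; simp [hij'] at h)] at this
    simp only [Pi.smul_apply, eps_apply, if_true, hij', if_false, Nat.cast_zero, zero_smul,
      sub_zero] at this
    exact mem_of_smul_mem (natCast_ne_zero_of_lt F p (by simp) (by simp; omega)) this
  rcases s with _ | s
  · simpa using h1 i i
  · have := S.lie_mem m1 (mem_pow h1 h2 h0 h3 j (s + 1))
    rw [W.lie_e_of_eq 0 (eps i + (s + 1) • eps j) (by intro h; simp [hij'] at h)
      (by intro _ t; simp; split_ifs <;> omega)] at this
    simpa [hij, hij'] using this

lemma mem_mul (hp : 5 ≤ p) (h1 : ∀ j i, W.e (eps j) i ∈ S)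
    (h2 : ∀ i, W.e (2 • eps i) i ∈ S) (h0 : ∀ i, W.D i ∈ S) (h3 : ∀ i, W.e (3 • eps i) i ∈ S) (i : Fin n)
    (b : Fin n → ℕ) (hb : b i = 0) : W.e (eps i + b) i ∈ S := by
  by_cases hbp : ∃ t, p ≤ b t
  · obtain ⟨t, ht⟩ := hbp
    rw [W.e_eq_zero _ i t (by simp; omega)]; exact S.zero_mem
  push Not at hbp
  have key : ∀ s : Finset (Fin n), W.e (eps i + fun t => if t ∈ s then b t else 0) i ∈ S := by
    intro s
    induction s using Finset.induction_on with
    | empty => simpa [← Pi.zero_def] using h1 i i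
    | insert k s hk ih =>
      by_cases hki : k = i
      · subst hki
        convert ih using 3
        ext t
        by_cases htk : t = k
        · subst htk; simp [hb]
        · simp [htk]
      by_cases hs : ∃ j ∈ s, b j ≠ 0
      · obtain ⟨j, hjs, hbj⟩ := hs
        have hji : j ≠ i := by rintro rfl; exact hbj hb
        have hjk : j ≠ k := by rintro rfl; exact hk hjs
        have := S.lie_mem (mem_mul_pow hp h1 h2 h0 h3 j k hjk.symm (b k)) ih
        rw [W.lie_e_of_eq (eps i + fun t => if t ∈ insert k s then b t else 0) 0
          (by
            intro _ t
            by_cases htk : t = k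
            · subst htk; simp [hk]; omega
            · simp [htk]; omega)
          (by intro h; simp [hji.symm, Ne.symm hki] at h)] at this
        simp only [Pi.add_apply, Pi.smul_apply, eps_apply, hji, hjs, hji.symm,
          Ne.symm hki, if_true, if_false, smul_zero, add_zero, zero_add, Nat.cast_zero, zero_smul,
          sub_zero] at this
        exact mem_of_smul_mem (natCast_ne_zero_of_lt F p hbj (hbp j)) this
      · push Not at hs
        convert mem_mul_pow hp h1 h2 h0 h3 i k hki (b k) using 3
        ext t
        by_cases htk : t = k
        · subst htk; simp
        · simp only [Finset.mem_insert, htk, false_or, Pi.smul_apply, eps_apply, if_false,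
            smul_zero, ite_eq_right_iff]
          exact hs t
  simpa using key Finset.univ

/-- A subalgebra containing `D_i`, all `x_j D_i`, `x_i² D_i` and `x_i³ D_i` is everything. -/
lemma mem_of_generators (hp : 5 ≤ p) (h1 : ∀ j i, W.e (eps j) i ∈ S)
    (h2 : ∀ i, W.e (2 • eps i) i ∈ S) (h0 : ∀ i, W.D i ∈ S) (h3 : ∀ i, W.e (3 • eps i) i ∈ S) (x : L) :
    x ∈ S := by
  have key : ∀ a i, W.e a i ∈ S := by
    intro a i
    by_cases hap : ∃ t, p ≤ a t
    · obtain ⟨t, ht⟩ := hap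
      rw [W.e_eq_zero _ i t ht]; exact S.zero_mem
    push Not at hap
    by_cases hai : a i = 0
    · by_cases ha : a = 0
      · subst ha; exact h0 i
      · obtain ⟨j, hj⟩ := Function.ne_iff.1 ha
        have hji : j ≠ i := by rintro rfl; exact hj hai
        have hj' : a j ≠ 0 := hj
        have := S.lie_mem (h1 j i) (mem_mul hp h1 h2 h0 h3 i (a - eps j) (by simp [hai]))
        rw [W.lie_e_of_eq a 0
          (by intro _ t; simp; split_ifs <;> subst_vars <;> omega)
          (by intro h; simp [hji.symm] at h)] at this
        simpa [hji.symm, hai] using this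
    · have hm := mem_mul hp h1 h2 h0 h3 i (fun t => if t = i then 0 else a t) (by simp)
      by_cases hai1 : a i = 1
      · convert hm using 2
        ext t
        by_cases hti : t = i
        · subst hti; simp [hai1]
        · simp [hti]
      · have := S.lie_mem (mem_pow h1 h2 h0 h3 i (a i)) hm
        rw [W.lie_e_of_eq a a
          (by intro _ t; by_cases hti : t = i <;> simp [hti])
          (by intro _ t; by_cases hti : t = i <;> simp [hti]), ← sub_smul] at this
        refine mem_of_smul_mem (t := -((a i - 1 : ℕ) : F)) (neg_ne_zero.2
          (natCast_ne_zero_of_lt F p (by omega) (by have := hap i; omega))) ?_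
        convert this using 2
        rw [Nat.cast_sub (by omega)]
        simp
  have : (⊤ : Submodule F L) ≤ S.toSubmodule := by
    rw [← W.span_e, Submodule.span_le]
    rintro _ ⟨q, rfl⟩
    exact key _ _
  exact this Submodule.mem_top

end Generation

end WittFrame

namespace WittFrame

variable {F : Type*} [Field F] {p n : ℕ} {L : Type*} [LieRing L] [LieAlgebra F L]
  (W : WittFrame F p n L)

open Finset

lemma ev_lie (k i : Fin n) {a : Fin n → ℕ} (ha : a ≠ 0) (y : L) :
    W.ev k ⁅W.e a i, y⁆ = if i = k then -∑ j, (if a = eps j then W.ev j y else 0) else 0 := by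
  have : W.ev k ∘ₗ LieAlgebra.ad F L (W.e a i) =
      if i = k then -∑ j, (if a = eps j then W.ev j else 0) else 0 := by
    refine W.hom_ext fun b j _ => ?_
    rw [LinearMap.comp_apply, LieAlgebra.ad_apply, W.lie_e, map_sub, map_smul, map_smul, W.ev_e,
      W.ev_e]
    have z1 : (b i : F) • (if a + b - eps i = 0 ∧ j = k then (1 : F) else 0) = 0 := by
      by_cases hb : b i = 0
      · simp [hb]
      · rw [if_neg, smul_zero]
        rintro ⟨h, -⟩
        obtain ⟨t, ht⟩ := Function.ne_iff.1 ha
        have ht' : a t ≠ 0 := ht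
        have := congrFun h t
        simp only [Pi.sub_apply, Pi.add_apply, eps_apply, Pi.zero_apply] at this
        split_ifs at this with h1
        · subst h1; omega
        · omega
    rw [z1, zero_sub]
    by_cases hi : i = k
    · simp only [hi, and_true, if_true, LinearMap.neg_apply, LinearMap.sum_apply, neg_inj]
      rw [sum_eq_single j]
      · by_cases haj : a = eps j
        · subst haj
          rw [if_pos rfl, W.ev_e]
          by_cases hb : b = 0
          · subst hb; simp
          · rw [if_neg, if_neg] <;> simp [hb]
        · rw [if_neg haj, LinearMap.zero_apply]
          by_cases haj0 : a j = 0
          · simp [haj0]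
          · rw [if_neg, smul_zero]
            intro h
            apply haj
            ext t
            have := congrFun h t
            simp only [Pi.sub_apply, Pi.add_apply, eps_apply, Pi.zero_apply] at this ⊢
            split_ifs at this ⊢ with h1
            · subst h1; omega
            · omega
      · intro l _ hl
        split_ifs
        · rw [W.ev_e, if_neg]
          rintro ⟨-, h⟩
          exact hl h.symm
        · simp
      · simp
    · simp [hi]
  have := LinearMap.congr_fun this y
  rw [LinearMap.comp_apply, LieAlgebra.ad_apply] at this
  rw [this]
  split_ifs
  · rw [LinearMap.neg_apply, LinearMap.sum_apply, neg_inj]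
    refine sum_congr rfl fun j _ => ?_
    split_ifs <;> simp
  · rfl

lemma ev_lie_eps (k i t : Fin n) (y : L) :
    W.ev k ⁅W.e (eps t) i, y⁆ = if i = k then -W.ev t y else 0 := by
  rw [W.ev_lie k i (eps_ne_zero t)]
  split_ifs
  · rw [sum_eq_single t]
    · simp
    · intro j _ hj
      rw [if_neg]
      intro h
      have := congrFun h t
      simp [Ne.symm hj] at this
    · simp
  · rfl

lemma ev_lie_of_ne (k i : Fin n) {a : Fin n → ℕ} (ha : a ≠ 0) (ha' : ∀ j, a ≠ eps j) (y : L) :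
    W.ev k ⁅W.e a i, y⁆ = 0 := by
  rw [W.ev_lie k i ha]
  simp [ha']

lemma commute_dd (i j : Fin n) : Commute (W.dd i) (W.dd j) := by
  refine LinearMap.ext fun y => ?_
  simp only [Module.End.mul_apply, dd_apply]
  rw [leibniz_lie]
  simp

lemma commute_dd_X {i j : Fin n} (h : i ≠ j) : Commute (W.dd i) (W.X j) := by
  refine LinearMap.ext fun y => ?_
  simp only [Module.End.mul_apply, dd_apply]
  rw [lie_D_X, if_neg h, add_zero]

lemma weyl_rel (i : Fin n) (y : L) : W.dd i (W.X i y) = W.X i (W.dd i y) + y := by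
  simp [lie_D_X]

lemma lie_eq_zero_comm {x y : L} (h : ⁅x, y⁆ = 0) : ⁅y, x⁆ = 0 := by
  rw [← lie_skew, h, neg_zero]

/-- The Euler element. -/
def euler : L := ∑ t, W.h t

lemma lie_euler_e (a : Fin n → ℕ) (i : Fin n) :
    ⁅W.euler, W.e a i⁆ = (((∑ t, a t : ℕ) : F) - 1) • W.e a i := by
  rw [euler, sum_lie]
  simp only [lie_h_e, ← sum_smul, sum_sub_distrib, Nat.cast_sum]
  simp

lemma lie_D_euler (j : Fin n) : ⁅W.D j, W.euler⁆ = W.D j := by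
  rw [← lie_skew, D, lie_euler_e]; simp

lemma toEnd_pow_ad (i : Fin n) (k : ℕ) (v : L) :
    (LieModule.toEnd F L (L →ₗ[F] L) (W.D i) ^ k) (LieAlgebra.ad F L v) =
      LieAlgebra.ad F L ((W.dd i ^ k) v) := by
  induction k with
  | zero => simp
  | succ k ih =>
    rw [pow_succ', Module.End.mul_apply, ih, pow_succ', Module.End.mul_apply]
    ext y
    simp [LieHom.lie_apply]

variable [CharP F p]

lemma eq_zero_of_ad_eq_zero (W : WittFrame F p n L) (hp : p.Prime) (z : L) (hz : ∀ x : L, ⁅x, z⁆ = 0) : z = 0 := by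
  refine W.eq_zero_of_lie_eq_zero hp z (fun j => hz _) fun k => ?_
  have := W.ev_lie_eps k k k z
  rw [hz, map_zero, if_pos rfl] at this
  exact neg_eq_zero.1 this.symm

lemma toEnd_D_pow (hp : p.Prime) (i : Fin n) :
    LieModule.toEnd F L (L →ₗ[F] L) (W.D i) ^ p = 0 := by
  have h := W.dd_pow_p i
  have := toEnd_hom_pow (F := F) (M := L) (N := L) p hp (W.D i) 0 (by rw [zero_smul]; exact h)
    (by rw [zero_smul]; exact h)
  rwa [zero_smul] at this

lemma toEnd_D_pow' (hp : p.Prime) (i : Fin n) :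
    LieModule.toEnd F L (L →ₗ[F] L →ₗ[F] L) (W.D i) ^ p = 0 := by
  have h := W.dd_pow_p i
  have := toEnd_hom_pow (F := F) (M := L) (N := L →ₗ[F] L) p hp (W.D i) 0
    (by rw [zero_smul]; exact h) (by rw [zero_smul]; exact W.toEnd_D_pow hp i)
  rwa [zero_smul] at this

lemma toEnd_h_pow (hp : p.Prime) (t : Fin n) :
    LieModule.toEnd F L (L →ₗ[F] L →ₗ[F] L) (W.h t) ^ p =
      LieModule.toEnd F L (L →ₗ[F] L →ₗ[F] L) (W.h t) := by
  have h := W.ad_h_pow hp t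
  have h1 := toEnd_hom_pow (F := F) (M := L) (N := L) p hp (W.h t) 1 (by rw [one_smul]; exact h)
    (by rw [one_smul]; exact h)
  have := toEnd_hom_pow (F := F) (M := L) (N := L →ₗ[F] L) p hp (W.h t) 1
    (by rw [one_smul]; exact h) h1
  rwa [one_smul] at this

lemma exists_ad_D (hp : p.Prime) (δ : L →ₗ[F] L)
    (hδ : ∀ x y : L, δ ⁅x, y⁆ = ⁅δ x, y⁆ + ⁅x, δ y⁆) (s : Finset (Fin n)) :
    ∃ z : L, ∀ j ∈ s, δ (W.D j) = ⁅z, W.D j⁆ := by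
  induction s using Finset.induction_on with
  | empty => exact ⟨0, by simp⟩
  | insert i s hi ih =>
    obtain ⟨z, hz⟩ := ih
    set δ' : L →ₗ[F] L := δ - LieAlgebra.ad F L z with hδ'def
    have hδ' : ∀ x y : L, δ' ⁅x, y⁆ = ⁅δ' x, y⁆ + ⁅x, δ' y⁆ := by
      intro x y
      simp only [hδ'def, LinearMap.sub_apply, LieAlgebra.ad_apply, hδ, sub_lie, lie_sub,
        leibniz_lie z x y]
      abel
    have hs : ∀ j ∈ s, δ' (W.D j) = 0 := fun j hj => by simp [hδ'def, hz j hj]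
    set v := δ' (W.D i) with hv
    have hvs : ∀ j ∈ s, ⁅W.D j, v⁆ = 0 := by
      intro j hj
      have := hδ' (W.D j) (W.D i)
      rw [hs j hj] at this
      simpa using this.symm
    have e1 : LieModule.toEnd F L (L →ₗ[F] L) (W.D i) δ' = -LieAlgebra.ad F L v := by
      ext y
      simp only [LieModule.toEnd_apply_apply, LieHom.lie_apply, hδ', LinearMap.neg_apply,
        LieAlgebra.ad_apply]
      abel
    have e2 : (W.dd i ^ (p - 1)) v = 0 := by
      have h1 := LinearMap.congr_fun (W.toEnd_D_pow hp i) δ'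
      rw [← pow_sub_one_mul hp.ne_zero, Module.End.mul_apply, e1, map_neg,
        toEnd_pow_ad, LinearMap.zero_apply, neg_eq_zero] at h1
      refine W.eq_zero_of_ad_eq_zero hp _ fun x => ?_
      have := LinearMap.congr_fun h1 x
      exact lie_eq_zero_comm this
    have e3 := apply_poincare p (W.dd i) (W.X i) (W.weyl_rel i) v e2
    refine ⟨z - poincare p (W.dd i) (W.X i) v, fun j hj => ?_⟩
    rw [sub_lie, ← lie_skew (poincare p (W.dd i) (W.X i) v), sub_neg_eq_add]
    rcases Finset.mem_insert.1 hj with rfl | hjs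
    · rw [dd_apply] at e3
      rw [e3, hv]
      simp [hδ'def]
    · have hji : j ≠ i := by rintro rfl; exact hi hjs
      have := LinearMap.congr_fun (commute_poincare p (W.dd i) (W.X i) (W.dd j)
        (W.commute_dd j i) (W.commute_dd_X hji)) v
      simp only [Module.End.mul_apply, dd_apply, hvs j hjs, map_zero] at this
      rw [this, hz j hjs, add_zero]

/-- Every derivation is inner. -/
lemma exists_eq_ad (W : WittFrame F p n L) (hp : p.Prime) (hp5 : 5 ≤ p) (δ : L →ₗ[F] L)
    (hδ : ∀ x y : L, δ ⁅x, y⁆ = ⁅δ x, y⁆ + ⁅x, δ y⁆) : ∃ z : L, δ = LieAlgebra.ad F L z := by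
  obtain ⟨z, hz⟩ := W.exists_ad_D hp δ hδ univ
  set v := δ W.euler - ⁅z, W.euler⁆ with hv
  set δ' : L →ₗ[F] L := δ - LieAlgebra.ad F L (z + v) with hδ'def
  have hvD : ∀ j, ⁅W.D j, v⁆ = 0 := by
    intro j
    have := hδ (W.D j) W.euler
    rw [lie_D_euler, hz j (mem_univ j)] at this
    rw [hv, lie_sub, leibniz_lie (W.D j) z, lie_D_euler, ← lie_skew (W.D j) z, neg_lie]
    nth_rewrite 2 [this]
    abel
  have heuler : ∀ y : L, (∀ j, ⁅W.D j, y⁆ = 0) → ⁅W.euler, y⁆ = -y := by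
    intro y hy
    rw [W.eq_sum_D_of_lie_eq_zero hp y hy, lie_sum, ← sum_neg_distrib]
    refine sum_congr rfl fun k _ => ?_
    rw [lie_smul, ← lie_skew, lie_D_euler, smul_neg]
  have hδ' : ∀ x y : L, δ' ⁅x, y⁆ = ⁅δ' x, y⁆ + ⁅x, δ' y⁆ := by
    intro x y
    simp only [hδ'def, LinearMap.sub_apply, LieAlgebra.ad_apply, hδ, sub_lie, lie_sub,
      leibniz_lie (z + v) x y]
    abel
  have hD : ∀ j, δ' (W.D j) = 0 := fun j => by
    simp [hδ'def, hz j (mem_univ j), lie_eq_zero_comm (hvD j)]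
  have hE : δ' W.euler = 0 := by
    rw [hδ'def, LinearMap.sub_apply, LieAlgebra.ad_apply, add_lie, ← lie_skew v, heuler v hvD]
    rw [hv]; abel
  have hdeg : ∀ d < p, ∀ a i, ∑ t, a t = d → δ' (W.e a i) = 0 := by
    intro d
    induction d with
    | zero =>
      intro _ a i ha
      have : a = 0 := by
        ext t
        exact Finset.sum_eq_zero_iff.1 ha t (mem_univ t)
      subst this
      exact hD i
    | succ d ih =>
      intro hd a i ha
      have hc : ∀ j, ⁅W.D j, δ' (W.e a i)⁆ = 0 := by
        intro j
        have := hδ' (W.D j) (W.e a i)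
        rw [hD j, zero_lie, zero_add, lie_D_e, map_smul] at this
        rw [← this]
        by_cases haj : a j = 0
        · simp [haj]
        · rw [ih (by omega), smul_zero]
          have h1 : ∑ t, (a - eps j) t + ∑ t, eps j t = ∑ t, a t := by
            rw [← sum_add_distrib]
            refine sum_congr rfl fun t _ => ?_
            simp only [Pi.sub_apply, eps_apply]
            split_ifs with h
            · subst h; omega
            · omega
          have h2 : ∑ t, eps j t = 1 := by simp
          omega
      have h1 := hδ' W.euler (W.e a i)
      rw [lie_euler_e, hE, zero_lie, zero_add, heuler _ hc, map_smul, ha, sub_smul, one_smul] at h1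
      have h2 : ((d + 1 : ℕ) : F) • δ' (W.e a i) = 0 := by
        rw [← sub_eq_zero] at h1
        rw [← h1]; abel
      exact (smul_eq_zero.1 h2).resolve_left (natCast_ne_zero_of_lt F p (by omega) hd)
  let S : LieSubalgebra F L :=
    { LinearMap.ker δ' with
      lie_mem' := by
        intro x y hx hy
        have hx' : δ' x = 0 := hx
        have hy' : δ' y = 0 := hy
        change δ' ⁅x, y⁆ = 0
        rw [hδ', hx', hy', zero_lie, lie_zero, add_zero] }
  refine ⟨z + v, ?_⟩
  rw [← sub_eq_zero]
  refine LinearMap.ext fun x => ?_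
  exact mem_of_generators (W := W) (S := S) hp5
    (fun j i => hdeg 1 (by omega) _ _ (by simp))
    (fun i => hdeg 2 (by omega) _ _ (by simp)) hD
    (fun i => hdeg 3 (by omega) _ _ (by simp)) x

end WittFrame

section Normalization

open Finset LieModule

variable {F : Type*} [Field F] {p n : ℕ} {L : Type*} [LieRing L] [LieAlgebra F L]
  (W : WittFrame F p n L)

lemma dOne_zero : dOne (0 : L →ₗ[F] L) = 0 := by ext x y; simp

lemma toEnd_bilin_pow_dOne (h : L) (k : ℕ) (g : L →ₗ[F] L) :
    (toEnd F L (L →ₗ[F] L →ₗ[F] L) h ^ k) (dOne g) = dOne ((toEnd F L (L →ₗ[F] L) h ^ k) g) := by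
  induction k with
  | zero => rfl
  | succ k ih =>
    rw [pow_succ', Module.End.mul_apply, ih, pow_succ', Module.End.mul_apply, toEnd_apply_apply,
      lie_dOne, toEnd_apply_apply]

lemma eq_lie_of_dOne_eq_zero {δ : L →ₗ[F] L} (h : dOne δ = 0) (x y : L) :
    δ ⁅x, y⁆ = ⁅δ x, y⁆ + ⁅x, δ y⁆ := by
  have := LinearMap.congr_fun₂ h x y
  rw [dOne_apply, LinearMap.zero_apply, LinearMap.zero_apply, ← lie_skew y] at this
  rw [← sub_eq_zero, ← neg_eq_zero, ← this]; abel

lemma toEnd_hom_pow_apply (h u : L) (hu : ⁅h, u⁆ = 0) (k : ℕ) (f : L →ₗ[F] L) :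
    ((toEnd F L (L →ₗ[F] L) h ^ k) f) u = (LieAlgebra.ad F L h ^ k) (f u) := by
  induction k with
  | zero => rfl
  | succ k ih =>
    rw [pow_succ', Module.End.mul_apply, toEnd_apply_apply, LieHom.lie_apply, hu, map_zero,
      sub_zero, ih, pow_succ', Module.End.mul_apply, LieAlgebra.ad_apply]

lemma pow_compRight_apply (T : Module.End F L) (k : ℕ) (f : L →ₗ[F] L) (u : L) :
    (((LinearMap.compRight F T : Module.End F (L →ₗ[F] L)) ^ k) f) u = (T ^ k) (f u) := by
  induction k with
  | zero => rfl
  | succ k ih =>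
    rw [pow_succ', Module.End.mul_apply, LinearMap.compRight_apply, LinearMap.comp_apply, ih,
      pow_succ', Module.End.mul_apply]

lemma poincare_hom_apply (T : Module.End F L) (h u : L) (hu : ⁅h, u⁆ = 0) (f : L →ₗ[F] L) :
    (poincare p (toEnd F L (L →ₗ[F] L) h) (LinearMap.compRight F T) f) u =
      poincare p (LieAlgebra.ad F L h) T (f u) := by
  simp only [poincare, LinearMap.sum_apply, LinearMap.smul_apply, Module.End.mul_apply,
    pow_compRight_apply, toEnd_hom_pow_apply h u hu]

lemma weyl_pow_pow (N X : Module.End F L) (h : ∀ m, N (X m) = X (N m) + m) (z : L) (hz : N z = 0)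
    (k : ℕ) : (N ^ k) ((X ^ k) z) = (k.factorial : F) • z := by
  induction k with
  | zero => simp
  | succ k ih =>
    rw [pow_succ N, Module.End.mul_apply, weyl_pow N X h, hz, map_zero, zero_add,
      Nat.add_sub_cancel, map_smul, ih, smul_smul, Nat.factorial_succ, Nat.cast_mul]

namespace WittFrame

lemma weyl_rel_hom (i : Fin n) (f : L →ₗ[F] L) :
    toEnd F L (L →ₗ[F] L) (W.D i) (LinearMap.compRight F (W.X i) f) =
      LinearMap.compRight F (W.X i) (toEnd F L (L →ₗ[F] L) (W.D i) f) + f := by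
  ext y
  simp only [toEnd_apply_apply, LieHom.lie_apply, LinearMap.compRight_apply,
    LinearMap.comp_apply, LinearMap.add_apply, lie_D_X, if_true, map_sub]
  abel

lemma commute_toEnd_compRight {i j : Fin n} (h : j ≠ i) :
    Commute (toEnd F L (L →ₗ[F] L) (W.D j)) (LinearMap.compRight F (W.X i)) := by
  refine LinearMap.ext fun f => LinearMap.ext fun y => ?_
  simp only [Module.End.mul_apply, toEnd_apply_apply, LieHom.lie_apply, LinearMap.compRight_apply,
    LinearMap.comp_apply, lie_D_X, if_neg h, map_sub, add_zero]

lemma commute_toEnd_D {M : Type*} [AddCommGroup M] [Module F M] [LieRingModule L M]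
    [LieModule F L M] (i j : Fin n) : Commute (toEnd F L M (W.D i)) (toEnd F L M (W.D j)) := by
  refine LinearMap.ext fun f => ?_
  simp only [Module.End.mul_apply, toEnd_apply_apply]
  rw [leibniz_lie, lie_D_D, zero_lie, zero_add]

variable [CharP F p]

lemma exists_normalize_D (hp : p.Prime) (hp5 : 5 ≤ p) {c : L →ₗ[F] L →ₗ[F] L} (hc : IsCoc c)
    (s : Finset (Fin n)) : ∃ g : L →ₗ[F] L, ∀ j ∈ s, (c - dOne g) (W.D j) = 0 := by
  induction s using Finset.induction_on with
  | empty => exact ⟨0, by simp⟩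
  | insert i s hi ih =>
    obtain ⟨g, hg⟩ := ih
    set c' := c - dOne g with hc'def
    have hc' : IsCoc c' := hc.sub (IsCoc.dOne g)
    set f := c' (W.D i) with hf
    set N := toEnd F L (L →ₗ[F] L) (W.D i) with hN
    have hfj : ∀ j ∈ s, ⁅W.D j, f⁆ = 0 := by
      intro j hj
      have h1 := hc'.lie_eq (W.D j)
      rw [hg j hj, dOne_zero] at h1
      ext y
      have h2 := LinearMap.congr_fun₂ h1 (W.D i) y
      rw [lie_bilin_apply, lie_D_D] at h2
      rw [LieHom.lie_apply]
      simpa [hf] using h2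
    have hfD : ∀ j ∈ insert i s, f (W.D j) = 0 := by
      intro j hj
      rcases Finset.mem_insert.1 hj with rfl | hjs
      · exact hc'.alt _
      · rw [hf, hc'.swap, hg j hjs]; simp
    have hder : dOne ((N ^ (p - 1)) f) = 0 := by
      rw [hN, ← toEnd_bilin_pow_dOne, hf, ← hc'.lie_eq (W.D i),
        ← toEnd_apply_apply F L (L →ₗ[F] L →ₗ[F] L), ← Module.End.mul_apply, pow_sub_one_mul hp.ne_zero,
        W.toEnd_D_pow' hp, LinearMap.zero_apply]
    obtain ⟨z, hz⟩ := W.exists_eq_ad hp hp5 _ (eq_lie_of_dOne_eq_zero hder)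
    have hzD : ∀ j ∈ insert i s, ⁅W.D j, z⁆ = 0 := by
      intro j hj
      have := LinearMap.congr_fun hz (W.D j)
      rw [hN, toEnd_hom_pow_apply _ _ (W.lie_D_D i j), hfD j hj, map_zero,
        LieAlgebra.ad_apply] at this
      exact lie_eq_zero_comm this.symm
    have hzi : ⁅W.D i, z⁆ = 0 := hzD i (mem_insert_self _ _)
    set w := ((p - 1).factorial : F)⁻¹ • (W.X i ^ (p - 1)) z with hw
    have hw1 : (W.dd i ^ (p - 1)) w = z := by
      rw [hw, map_smul, weyl_pow_pow _ _ (W.weyl_rel i) z hzi, smul_smul, inv_mul_cancel₀, one_smul]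
      exact factorial_cast_ne_zero F p hp (by omega)
    have hw2 : weylProj p (W.dd i) (W.X i) w = 0 := by
      rw [hw, map_smul, show p - 1 = (p - 2) + 1 by omega, pow_succ', Module.End.mul_apply,
        W.weylProj_X hp, smul_zero]
    have hwj : ∀ j ∈ s, ⁅W.D j, w⁆ = 0 := by
      intro j hj
      have hji : j ≠ i := by rintro rfl; exact hi hj
      have := LinearMap.congr_fun ((W.commute_dd_X hji).pow_right (p - 1)) z
      simp only [Module.End.mul_apply, dd_apply, hzD j (mem_insert_of_mem hj), map_zero] at this
      rw [hw, lie_smul, this, smul_zero]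
    set f' := f - LieAlgebra.ad F L w with hf'
    have hNf' : (N ^ (p - 1)) f' = 0 := by
      rw [hf', map_sub, hz, hN, toEnd_pow_ad, hw1, sub_self]
    set g' := poincare p N (LinearMap.compRight F (W.X i)) f' with hg'
    have hNg' : N g' = f' := apply_poincare p _ _ (W.weyl_rel_hom i) _ hNf'
    have hjg' : ∀ j ∈ s, ⁅W.D j, g'⁆ = 0 := by
      intro j hj
      have hji : j ≠ i := by rintro rfl; exact hi hj
      have h1 := LinearMap.congr_fun (commute_poincare p N (LinearMap.compRight F (W.X i))
        (toEnd F L (L →ₗ[F] L) (W.D j)) (W.commute_toEnd_D j i) (W.commute_toEnd_compRight hji)) f'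
      have h2 : ⁅W.D j, f'⁆ = 0 := by
        have := W.toEnd_pow_ad j 1 w
        rw [pow_one, pow_one, toEnd_apply_apply, dd_apply, hwj j hj, map_zero] at this
        rw [hf', lie_sub, hfj j hj, this, sub_zero]
      rw [Module.End.mul_apply, Module.End.mul_apply, toEnd_apply_apply, toEnd_apply_apply, h2,
        map_zero] at h1
      exact h1
    have hg'D : ∀ j, g' (W.D j) = poincare p (W.dd i) (W.X i) (f' (W.D j)) := fun j =>
      poincare_hom_apply _ _ _ (W.lie_D_D i j) f'
    have hg'j : ∀ j ∈ s, g' (W.D j) = 0 := by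
      intro j hj
      rw [hg'D, hf', LinearMap.sub_apply, hfD j (mem_insert_of_mem hj), LieAlgebra.ad_apply,
        lie_eq_zero_comm (hwj j hj), sub_zero, map_zero]
    have hg'i : g' (W.D i) = w := by
      rw [hg'D, hf', LinearMap.sub_apply, hfD i (mem_insert_self _ _), LieAlgebra.ad_apply, zero_sub,
        lie_skew, ← dd_apply, poincare_apply_apply p hp.pos, hw2, sub_zero]
    have key : ∀ j y, dOne g' (W.D j) y = ⁅W.D j, g'⁆ y - ⁅y, g' (W.D j)⁆ := by
      intro j y
      rw [dOne_apply, LieHom.lie_apply]; abel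
    refine ⟨g + g', fun j hj => ?_⟩
    rw [dOne_add, ← sub_sub, ← hc'def]
    ext y
    rw [LinearMap.sub_apply, LinearMap.sub_apply, key, LinearMap.zero_apply]
    rcases Finset.mem_insert.1 hj with rfl | hjs
    · rw [← toEnd_apply_apply F, hNg', hg'i, hf', ← hf, LinearMap.sub_apply,
        LieAlgebra.ad_apply, ← lie_skew y w]
      abel
    · rw [hg j hjs, hjg' j hjs, hg'j j hjs]
      simp

lemma exists_normalize_h (hp : p.Prime) (hp5 : 5 ≤ p) {c : L →ₗ[F] L →ₗ[F] L} (hc : IsCoc c)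
    (hD : ∀ j, c (W.D j) = 0) (s : Finset (Fin n)) :
    ∃ g : L →ₗ[F] L, (∀ j, (c - dOne g) (W.D j) = 0) ∧ ∀ t ∈ s, ⁅W.h t, c - dOne g⁆ = 0 := by
  induction s using Finset.induction_on with
  | empty => exact ⟨0, by simpa [dOne_zero] using hD⟩
  | insert t s hts ih =>
    obtain ⟨g, hgD, hgs⟩ := ih
    set c' := c - dOne g with hc'def
    have hc' : IsCoc c' := hc.sub (IsCoc.dOne g)
    set T := toEnd F L (L →ₗ[F] L →ₗ[F] L) (W.h t) with hT
    have hcoc : ∀ k, IsCoc ((T ^ k) c') := by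
      intro k
      induction k with
      | zero => exact hc'
      | succ k ih =>
        rw [pow_succ', Module.End.mul_apply, hT, toEnd_apply_apply, ih.lie_eq]
        exact IsCoc.dOne _
    have hTD : ∀ k j, ((T ^ k) c') (W.D j) = 0 := by
      intro k
      induction k with
      | zero => exact hgD
      | succ k ih =>
        intro j
        ext y
        rw [pow_succ', Module.End.mul_apply, hT, toEnd_apply_apply, lie_bilin_apply, ← hT, ih,
          D, lie_h_e, map_smul, ← D, ih]
        simp
    have hTs : ∀ k, ∀ r ∈ s, ⁅W.h r, (T ^ k) c'⁆ = 0 := by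
      intro k r hr
      have hcm : Commute (toEnd F L (L →ₗ[F] L →ₗ[F] L) (W.h r)) T := by
        refine LinearMap.ext fun f => ?_
        have : ⁅W.h r, W.h t⁆ = 0 := by
          rw [show W.h t = W.e (eps t) t from rfl, lie_h_e]
          by_cases h : t = r
          · simp [h]
          · simp [h, Ne.symm h]
        simp only [hT, Module.End.mul_apply, toEnd_apply_apply]
        rw [leibniz_lie, this, zero_lie, zero_add]
      have := LinearMap.congr_fun (hcm.pow_right k) c'
      rw [Module.End.mul_apply, Module.End.mul_apply, toEnd_apply_apply, toEnd_apply_apply, hgs r hr,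
        map_zero] at this
      exact this
    have e : (T ^ (p - 1)) c' = dOne ((T ^ (p - 2)) c' (W.h t)) := by
      rw [← (hcoc (p - 2)).lie_eq, show p - 1 = p - 2 + 1 by omega, pow_succ', Module.End.mul_apply,
        hT, toEnd_apply_apply]
    refine ⟨g + (T ^ (p - 2)) c' (W.h t), fun j => ?_, fun r hr => ?_⟩
    · rw [dOne_add, ← sub_sub, ← hc'def, ← e, LinearMap.sub_apply, hgD, hTD, sub_zero]
    · rw [dOne_add, ← sub_sub, ← hc'def, ← e, lie_sub]
      rcases Finset.mem_insert.1 hr with rfl | hrs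
      · rw [← toEnd_apply_apply F, ← toEnd_apply_apply F, ← hT, ← Module.End.mul_apply, ← pow_succ',
          Nat.sub_add_cancel hp.pos, hT, W.toEnd_h_pow hp, sub_self]
      · rw [hgs r hrs, hTs _ r hrs, sub_zero]

/-- Every cocycle is cohomologous to one vanishing on all `D_j` and all `x_t D_t`. -/
lemma exists_normalize (hp : p.Prime) (hp5 : 5 ≤ p) {c : L →ₗ[F] L →ₗ[F] L} (hc : IsCoc c) :
    ∃ g : L →ₗ[F] L, (∀ j, (c - dOne g) (W.D j) = 0) ∧ ∀ t, (c - dOne g) (W.h t) = 0 := by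
  obtain ⟨g₁, h₁⟩ := W.exists_normalize_D hp hp5 hc univ
  obtain ⟨g₂, h₂, h₃⟩ := W.exists_normalize_h hp hp5 (hc.sub (IsCoc.dOne g₁))
    (fun j => h₁ j (mem_univ j)) univ
  rw [sub_sub, ← dOne_add] at h₂ h₃
  refine ⟨g₁ + g₂, h₂, fun t => ?_⟩
  set c' := c - dOne (g₁ + g₂) with hc'def
  have hc' : IsCoc c' := hc.sub (IsCoc.dOne _)
  have hder := hc'.lie_eq (W.h t)
  rw [h₃ t (mem_univ t)] at hder
  obtain ⟨v, hv⟩ := W.exists_eq_ad hp hp5 _ (eq_lie_of_dOne_eq_zero hder.symm)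
  have hvD : ∀ j, ⁅W.D j, v⁆ = 0 := by
    intro j
    have := LinearMap.congr_fun hv (W.D j)
    rw [hc'.swap, h₂ j, LinearMap.zero_apply, neg_zero, LieAlgebra.ad_apply] at this
    exact lie_eq_zero_comm this.symm
  have hvh : ∀ s, ⁅W.h s, v⁆ = 0 := by
    intro s
    refine W.eq_zero_of_ad_eq_zero hp _ fun x => ?_
    have h5 := LinearMap.congr_fun₂ (h₃ s (mem_univ s)) (W.h t) x
    have : ⁅W.h s, W.h t⁆ = 0 := by
      rw [show W.h t = W.e (eps t) t from rfl, lie_h_e]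
      by_cases h : t = s
      · simp [h]
      · simp [h, Ne.symm h]
    rw [lie_bilin_apply, this, hv] at h5
    simp only [LieAlgebra.ad_apply, map_zero, LinearMap.zero_apply, sub_zero] at h5
    rw [leibniz_lie, add_sub_cancel_right] at h5
    exact lie_eq_zero_comm h5
  have : v = 0 := by
    refine W.eq_zero_of_lie_eq_zero hp v hvD fun k => ?_
    have := W.ev_lie_eps k k k v
    rw [show W.e (eps k) k = W.h k from rfl, hvh, map_zero, if_pos rfl] at this
    exact neg_eq_zero.1 this.symm
  rw [hv, this, map_zero]

end WittFrame

end Normalization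

section Functionals

open Finset

variable {F : Type*} [Field F] {p n : ℕ} {L : Type*} [LieRing L] [LieAlgebra F L]

namespace WittFrame

variable (W : WittFrame F p n L)

/-- The functional detecting `Sq(D_l)`. -/
lemma ev_dOne_sq (hp5 : 5 ≤ p) (l : Fin n) (g : L →ₗ[F] L) :
    W.ev l (dOne g (W.e (2 • eps l) l) (W.e ((p - 1) • eps l) l)) = 0 := by
  have hz : ⁅W.e (2 • eps l) l, W.e ((p - 1) • eps l) l⁆ = 0 := by
    rw [W.lie_e_of_eq (p • eps l) (p • eps l)
      (by intro _ t; simp; split_ifs <;> omega) (by intro _ t; simp; split_ifs <;> omega),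
      W.e_eq_zero _ l l (by simp)]
    simp
  have hne : ∀ m, 2 ≤ m → m • eps l ≠ 0 ∧ ∀ j, m • eps l ≠ eps j := by
    intro m hm
    refine ⟨fun h => ?_, fun j h => ?_⟩
    · have := congrFun h l
      simp at this; omega
    · have := congrFun h l
      simp at this; split_ifs at this <;> omega
  rw [dOne_apply, hz, map_zero, sub_zero, map_sub, W.ev_lie_of_ne l l (hne 2 le_rfl).1 (hne 2 le_rfl).2,
    W.ev_lie_of_ne l l (hne (p - 1) (by omega)).1 (hne (p - 1) (by omega)).2, sub_zero]

variable [CharP F p]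

/-- Weight homogeneity of the coefficients of a torus invariant cocycle. -/
lemma weight_cases (hp5 : 5 ≤ p) {c : L →ₗ[F] L →ₗ[F] L} (hc : IsCoc c)
    (hh : ∀ t, c (W.h t) = 0) {k i j : Fin n} {a b : Fin n → ℕ}
    (hω : W.ev k (c (W.e a i) (W.e b j)) ≠ 0) (t : Fin n) :
    b t < p ∧
    (a t + b t + (if k = t then 1 else 0) = (if i = t then 1 else 0) + (if j = t then 1 else 0) ∨
    a t + b t + (if k = t then 1 else 0) =
      (if i = t then 1 else 0) + (if j = t then 1 else 0) + p) := by
  have ha : a t < p := by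
    by_contra h
    rw [W.e_eq_zero a i t (by omega)] at hω
    simp at hω
  have hb : b t < p := by
    by_contra h
    rw [W.e_eq_zero b j t (by omega)] at hω
    simp at hω
  refine ⟨hb, ?_⟩
  have h1 := hc.lie_eq (W.h t)
  rw [hh t, dOne_zero] at h1
  have h2 := congrArg (W.ev k) (LinearMap.congr_fun₂ h1 (W.e a i) (W.e b j))
  rw [lie_bilin_apply, lie_h_e, lie_h_e, show W.h t = W.e (eps t) t from rfl] at h2
  simp only [map_sub, map_smul, ev_lie_eps, LinearMap.zero_apply, map_zero, LinearMap.smul_apply,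
    smul_eq_mul] at h2
  set ω := W.ev k (c (W.e a i) (W.e b j)) with hωdef
  have h3 : ((a t + b t + (if k = t then 1 else 0) : ℕ) : F) =
      (((if i = t then 1 else 0) + (if j = t then 1 else 0) : ℕ) : F) := by
    refine mul_right_cancel₀ hω ?_
    rw [← sub_eq_zero, ← neg_eq_zero, ← h2]
    push_cast
    by_cases hkt : k = t
    · subst hkt
      simp only [if_true]
      rw [← hωdef]
      ring
    · simp only [hkt, Ne.symm hkt, if_false]
      ring
  rw [CharP.natCast_eq_natCast F p] at h3
  have e1 : (if k = t then 1 else 0 : ℕ) ≤ 1 := by split_ifs <;> omega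
  have e2 : (if i = t then 1 else 0 : ℕ) ≤ 1 := by split_ifs <;> omega
  have e3 : (if j = t then 1 else 0 : ℕ) ≤ 1 := by split_ifs <;> omega
  generalize (if k = t then 1 else 0 : ℕ) = q1 at *
  generalize (if i = t then 1 else 0 : ℕ) = q2 at *
  generalize (if j = t then 1 else 0 : ℕ) = q3 at *
  have h4 : (q2 + q3) % p = q2 + q3 := Nat.mod_eq_of_lt (by omega)
  have h5 : (a t + b t + q1) % p = q2 + q3 := (show (a t + b t + q1) % p = (q2 + q3) % p from h3).trans h4
  rcases Nat.lt_or_ge (a t + b t + q1) p with h | h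
  · rw [Nat.mod_eq_of_lt h] at h5; exact Or.inl h5
  · rw [Nat.mod_eq_sub_mod h, Nat.mod_eq_of_lt (by omega)] at h5; omega

lemma ev_sqCochain (hp : p.Prime) (hp5 : 5 ≤ p) (l j : Fin n) :
    W.ev l (sqCochain F p (fun z => ⁅W.D j, z⁆) (W.e (2 • eps l) l) (W.e ((p - 1) • eps l) l)) =
      if j = l then -3 else 0 := by
  have hit : ∀ k y, (fun z => ⁅W.D j, z⁆)^[k] y = (W.dd j ^ k) y := by
    intro k y
    rw [Module.End.pow_apply]; rfl
  simp only [sqCochain, hit, dd_pow_e]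
  by_cases hjl : j = l
  · subst hjl
    have hsub : ({1, 2} : Finset ℕ) ⊆ Icc 1 (p - 1) := by
      intro x hx
      simp only [mem_insert, mem_singleton] at hx
      rw [mem_Icc]; omega
    rw [← sum_subset hsub, sum_pair (by norm_num)]
    · have e1 : (2 • eps j - 1 • eps j : Fin n → ℕ) = eps j := by
        ext t; simp; split_ifs <;> rfl
      have e2 : ((p - 1) • eps j - (p - 1) • eps j : Fin n → ℕ) = 0 := by simp
      have e3 : (2 • eps j - 2 • eps j : Fin n → ℕ) = 0 := by simp
      have e4 : ((p - 1) • eps j - (p - 2) • eps j : Fin n → ℕ) = eps j := by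
        ext t; simp; split_ifs <;> omega
      have f1 := factorial_cast_ne_zero F p hp (m := p - 1) (by omega)
      have f2 := factorial_cast_ne_zero F p hp (m := p - 2) (by omega)
      have d1 : (p - 1).descFactorial (p - 1) = (p - 1).factorial := Nat.descFactorial_self _
      have d2 : (p - 1).descFactorial (p - 2) = (p - 1).factorial := by
        have := Nat.factorial_mul_descFactorial (show p - 2 ≤ p - 1 by omega)
        rwa [show p - 1 - (p - 2) = 1 by omega, Nat.factorial_one, one_mul] at this
      have d3 : (p - 1).factorial = (p - 1) * (p - 2).factorial := by
        rw [← Nat.mul_factorial_pred (by omega : p - 1 ≠ 0)]; rfl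
      have d4 : ((p - 1 : ℕ) : F) = -1 := by
        rw [Nat.cast_sub (by omega)]; simp
      have two : (2 : F) ≠ 0 := by
        exact_mod_cast natCast_ne_zero_of_lt F p (k := 2) (by omega) (by omega)
      have b1 : W.ev j ⁅W.e (eps j) j, W.e 0 j⁆ = -1 := by
        rw [ev_lie_eps, if_pos rfl, ev_e, if_pos ⟨rfl, rfl⟩]
      have b2 : W.ev j ⁅W.e 0 j, W.e (eps j) j⁆ = 1 := by
        rw [← lie_skew, map_neg, b1, neg_neg]
      rw [e1, e2, e3, e4]
      simp only [smul_lie, lie_smul, map_add, map_smul, b1, b2, smul_eq_mul, d1, d2, Pi.smul_apply,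
        eps_apply, if_true, smul_eq_mul, mul_one]
      rw [show p - 2 = p - 1 - 1 by omega] at f2 d3 ⊢
      rw [d3] at f1 ⊢
      push_cast at f1 ⊢
      rw [d4] at f1 ⊢
      norm_num [Nat.factorial, Nat.descFactorial]
      field_simp
      ring
    · intro x _ hx
      simp only [mem_insert, mem_singleton, not_or] at hx
      have : Nat.descFactorial 2 x = 0 := Nat.descFactorial_of_lt (by
        rw [mem_Icc] at *; omega)
      simp [this]
  · rw [if_neg hjl, map_sum]
    refine sum_eq_zero fun i hi => ?_
    rw [mem_Icc] at hi
    simp [hjl, Nat.descFactorial_of_lt hi.1]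

end WittFrame

end Functionals

section Normal

open Finset

lemma dOne_sum {F L ι : Type*} [Field F] [LieRing L] [LieAlgebra F L] (s : Finset ι) (μ : ι → F)
    (g : ι → L →ₗ[F] L) : dOne (∑ i ∈ s, μ i • g i) = ∑ i ∈ s, μ i • dOne (g i) := by
  ext x y
  simp only [dOne_apply, LinearMap.sum_apply, LinearMap.smul_apply, lie_sum, lie_smul,
    ← sum_sub_distrib, smul_sub]

variable {F : Type*} [Field F] {p n : ℕ} {L : Type*} [LieRing L] [LieAlgebra F L]

namespace WittFrame

variable (W : WittFrame F p n L)

/-- The operator `f D_s ↦ ∂_k^{p-1} ∂_s f D_k`, which is invariant under all `D_t` and `h_t`. -/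
def residue (k s : Fin n) : L →ₗ[F] L := W.dd k ^ (p - 1) * (W.dd s * W.R s k)

lemma residue_e (k s : Fin n) (a : Fin n → ℕ) (i : Fin n) :
    W.residue k s (W.e a i) =
      if i = s then ((a s : F) * (((a - eps s) k).descFactorial (p - 1) : F)) •
        W.e (a - eps s - (p - 1) • eps k) k else 0 := by
  rw [residue, Module.End.mul_apply, Module.End.mul_apply, W.R_e]
  split_ifs
  · rw [dd_apply, lie_D_e, map_smul, dd_pow_e, smul_smul]
  · simp

lemma commute_dd_R (s k t : Fin n) : Commute (W.dd t) (W.R s k) := by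
  refine W.hom_ext fun a i _ => ?_
  simp only [Module.End.mul_apply, dd_apply, lie_D_e, map_smul, W.R_e]
  split_ifs <;> simp [lie_D_e]

lemma dOne_residue_D (k s t : Fin n) : dOne (W.residue k s) (W.D t) = 0 := by
  have h0 : W.residue k s (W.D t) = 0 := by
    rw [D, residue_e]
    simp
  have hc : Commute (W.dd t) (W.residue k s) :=
    ((W.commute_dd t k).pow_right _).mul_right
      ((W.commute_dd t s).mul_right (W.commute_dd_R s k t))
  ext y
  have := LinearMap.congr_fun hc.eq y
  simp only [Module.End.mul_apply, dd_apply] at this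
  simp [h0, this]

lemma dOne_residue_h [CharP F p] (hp5 : 5 ≤ p) (k s t : Fin n) :
    dOne (W.residue k s) (W.h t) = 0 := by
  have h0 : W.residue k s (W.h t) = 0 := by
    rw [h, residue_e, Nat.descFactorial_of_lt]
    · simp
    · simp only [Pi.sub_apply, eps_apply]; split_ifs <;> omega
  refine W.hom_ext fun a i ha => ?_
  rw [dOne_apply, h0, lie_zero, sub_zero, lie_h_e, map_smul, residue_e]
  by_cases hi : i = s
  · subst hi
    rw [if_pos rfl, lie_smul, lie_h_e, LinearMap.zero_apply]
    by_cases h1 : a i = 0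
    · simp [h1]
    by_cases h2 : (a - eps i) k < p - 1
    · rw [Nat.descFactorial_of_lt h2]; simp
    have := ha i
    have := ha k
    have hik : i ≠ k := by
      rintro rfl
      simp at h2; omega
    have hk : a k = p - 1 := by
      simp [hik.symm] at h2; omega
    have key : (((a - eps i - (p - 1) • eps k) t : ℕ) : F) - (if k = t then 1 else 0) =
        (a t : F) - if i = t then 1 else 0 := by
      by_cases hit : t = i
      · subst hit
        simp [hik, hik.symm, Nat.cast_sub (Nat.one_le_iff_ne_zero.2 h1)]
      · by_cases hkt : t = k
        · subst hkt
          simp [hik, hik.symm, hk, Nat.cast_sub (show 1 ≤ p by omega)]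
        · simp [hit, hkt, Ne.symm hit, Ne.symm hkt]
    rw [key, smul_smul, smul_smul, mul_comm, sub_self]
  · simp [hi]

lemma ev_dOne_residue (hp5 : 5 ≤ p) (k s l t : Fin n) (hlt : t ≠ l) :
    W.ev l (dOne (W.residue k s) (W.e (2 • eps l) l) (W.e ((p - 2) • eps l + eps t) t)) =
      if k = l ∧ s = t then -(((p - 2 : ℕ) : F) * ((p - 1).factorial : F)) else 0 := by
  have h1 : ∀ j, (2 • eps l : Fin n → ℕ) ≠ eps j := fun j h => by
    have := congrFun h l
    simp at this; split_ifs at this; omega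
  have h2 : ∀ j, ((p - 2) • eps l + eps t : Fin n → ℕ) ≠ eps j := fun j h => by
    have := congrFun h l
    simp at this; split_ifs at this <;> omega
  have h3 : (2 • eps l : Fin n → ℕ) ≠ 0 := fun h => by
    have := congrFun h l
    simp at this
  have h4 : ((p - 2) • eps l + eps t : Fin n → ℕ) ≠ 0 := fun h => by
    have := congrFun h l
    simp at this; omega
  rw [dOne_apply, map_sub, map_sub, W.ev_lie_of_ne l l h3 h1, W.ev_lie_of_ne l t h4 h2,
    W.lie_e_of_eq ((p - 1) • eps l + eps t) 0 (by intro _ r; simp; split_ifs <;> omega)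
      (by intro h; simp [hlt] at h)]
  simp only [Pi.smul_apply, eps_apply, if_neg hlt, smul_zero, Nat.cast_zero, zero_smul, sub_zero,
    map_smul, residue_e, zero_sub]
  by_cases hts : s = t
  · subst hts
    by_cases hkl : k = l
    · subst hkl
      simp only [if_true, map_smul, W.ev_e, and_self]
      rw [if_pos]
      · simp [hlt, hlt.symm, Nat.descFactorial_self]
      · refine ⟨?_, trivial⟩
        ext r; simp
    · simp [hkl, W.ev_e]
  · simp [hts, Ne.symm hts]

/-- A torus invariant cocycle on which the functionals dual to the `Sq(D_l)` vanish can be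
normalized on the elements `x_l² D_l`. -/
theorem exists_normalize_sq [CharP F p] (hp : p.Prime) (hp5 : 5 ≤ p) {c : L →ₗ[F] L →ₗ[F] L}
    (hc : IsCoc c) (hD : ∀ j, c (W.D j) = 0) (hh : ∀ t, c (W.h t) = 0)
    (hΦ : ∀ l, W.ev l (c (W.e (2 • eps l) l) (W.e ((p - 1) • eps l) l)) = 0) :
    ∃ g : L →ₗ[F] L, (∀ j, (c - dOne g) (W.D j) = 0) ∧ (∀ t, (c - dOne g) (W.h t) = 0) ∧
      ∀ l y, W.ev l ((c - dOne g) (W.e (2 • eps l) l) y) = 0 := by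
  set κ : F := -(((p - 2 : ℕ) : F) * ((p - 1).factorial : F)) with hκ
  have hκ0 : κ ≠ 0 := neg_ne_zero.2 (mul_ne_zero
    (natCast_ne_zero_of_lt F p (by omega) (by omega)) (factorial_cast_ne_zero F p hp (by omega)))
  set g : L →ₗ[F] L := ∑ q : Fin n × Fin n,
    (W.ev q.1 (c (W.e (2 • eps q.1) q.1) (W.e ((p - 2) • eps q.1 + eps q.2) q.2)) / κ) •
      W.residue q.1 q.2 with hg
  have gD : ∀ j, (c - dOne g) (W.D j) = 0 := fun j => by
    rw [hg, dOne_sum, LinearMap.sub_apply, hD, LinearMap.sum_apply]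
    simp only [LinearMap.smul_apply, W.dOne_residue_D]
    simp
  have gh : ∀ t, (c - dOne g) (W.h t) = 0 := fun t => by
    rw [hg, dOne_sum, LinearMap.sub_apply, hh, LinearMap.sum_apply]
    simp only [LinearMap.smul_apply, W.dOne_residue_h hp5]
    simp
  refine ⟨g, gD, gh, fun l => ?_⟩
  suffices h : W.ev l ∘ₗ (c - dOne g) (W.e (2 • eps l) l) = 0 from
    fun y => LinearMap.congr_fun h y
  refine W.hom_ext fun b j _ => ?_
  rw [LinearMap.comp_apply, LinearMap.zero_apply]
  by_contra hω
  have hb := W.weight_cases hp5 (hc.sub (IsCoc.dOne g)) gh hω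
  by_cases hj : j = l
  · subst hj
    have : b = (p - 1) • eps j := by
      ext t
      have := hb t
      simp only [Pi.smul_apply, eps_apply, smul_eq_mul] at this ⊢
      by_cases htj : t = j
      · subst htj; simp at this ⊢; omega
      · simp [htj, Ne.symm htj] at this ⊢; omega
    subst this
    apply hω
    rw [LinearMap.sub_apply, LinearMap.sub_apply, map_sub, hΦ, ev_dOne_sq W hp5, sub_zero]
  · have : b = (p - 2) • eps l + eps j := by
      ext t
      have := hb t
      simp only [Pi.add_apply, Pi.smul_apply, eps_apply, smul_eq_mul] at this ⊢
      by_cases htl : t = l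
      · subst htl; simp [hj, Ne.symm hj] at this ⊢; omega
      · by_cases htj : t = j
        · subst htj; simp [htl, Ne.symm htl] at this ⊢; omega
        · simp [htj, Ne.symm htj, htl, Ne.symm htl] at this ⊢; omega
    subst this
    apply hω
    rw [hg, dOne_sum, LinearMap.sub_apply, LinearMap.sub_apply, map_sub, LinearMap.sum_apply,
      LinearMap.sum_apply, map_sum, sum_eq_single (l, j)]
    · simp only [LinearMap.smul_apply, map_smul, W.ev_dOne_residue hp5 _ _ _ _ hj]
      rw [if_pos ⟨trivial, trivial⟩, ← hκ, smul_eq_mul, div_mul_cancel₀ _ hκ0, sub_self]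
    · rintro ⟨k, s⟩ _ hks
      simp only [LinearMap.smul_apply, map_smul, W.ev_dOne_residue hp5 _ _ _ _ hj]
      rw [if_neg, smul_zero]
      rintro ⟨rfl, rfl⟩
      exact hks rfl
    · simp

end WittFrame

end Normal

section Vanishing

open Finset

variable {F : Type*} [Field F] {p n : ℕ} {L : Type*} [LieRing L] [LieAlgebra F L]

lemma IsCoc.ev_jac {c : L →ₗ[F] L →ₗ[F] L} (hc : IsCoc c) (φ : L →ₗ[F] F) {x y z : L}
    (hx : φ ⁅x, c y z⁆ = 0) (hy : φ ⁅y, c z x⁆ = 0) (hz : φ ⁅z, c x y⁆ = 0) :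
    φ (c x ⁅y, z⁆) + φ (c y ⁅z, x⁆) + φ (c z ⁅x, y⁆) = 0 := by
  have := congrArg φ (hc.jac x y z)
  simpa only [map_add, hx, hy, hz, zero_add, map_zero] using this

/-- The elements annihilating a cocycle form a subalgebra. -/
def IsCoc.radical {c : L →ₗ[F] L →ₗ[F] L} (hc : IsCoc c) : LieSubalgebra F L :=
  { LinearMap.ker c with
    lie_mem' := by
      intro x y hx hy
      replace hx : c x = 0 := hx
      replace hy : c y = 0 := hy
      change c ⁅x, y⁆ = 0
      ext z
      have := hc.jac x y z
      rw [hc.swap z x, hc.swap z ⁅x, y⁆, hx, hy] at this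
      simpa using this }

lemma IsCoc.mem_radical {c : L →ₗ[F] L →ₗ[F] L} (hc : IsCoc c) {x : L} :
    x ∈ hc.radical ↔ c x = 0 := Iff.rfl

namespace WittFrame

variable (W : WittFrame F p n L)

lemma ev_lie_of_ne_index {k i : Fin n} (hik : i ≠ k) {a : Fin n → ℕ} (t : Fin n) (ha : a t ≠ 0)
    (y : L) : W.ev k ⁅W.e a i, y⁆ = 0 := by
  rw [W.ev_lie k i (fun h => ha (congrFun h t)), if_neg hik]

lemma ev_lie_of_two_le (k i : Fin n) {a : Fin n → ℕ} (t : Fin n) (ha : 2 ≤ a t) (y : L) :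
    W.ev k ⁅W.e a i, y⁆ = 0 := by
  refine W.ev_lie_of_ne k i (fun h => ?_) (fun j h => ?_) y
  · rw [h] at ha; simp at ha
  · rw [h, eps_apply] at ha; split_ifs at ha <;> omega

lemma ev_lie_of_one_le (k i : Fin n) {a : Fin n → ℕ} {s t : Fin n} (hst : s ≠ t) (hs : 1 ≤ a s)
    (ht : 1 ≤ a t) (y : L) : W.ev k ⁅W.e a i, y⁆ = 0 := by
  refine W.ev_lie_of_ne k i (fun h => ?_) (fun j h => ?_) y
  · rw [h] at hs; simp at hs
  · rw [h, eps_apply] at hs ht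
    split_ifs at hs ht with h1 h2
    · exact hst (h1.trans h2.symm)
    all_goals omega

/-- Cocycles normalized on `D_j`, `x_j D_j` and `x_j² D_j`. -/
structure IsNormal (c : L →ₗ[F] L →ₗ[F] L) : Prop where
  coc : IsCoc c
  D : ∀ j, c (W.D j) = 0
  h : ∀ t, c (W.h t) = 0
  sq : ∀ l y, W.ev l (c (W.e (2 • eps l) l) y) = 0

variable {W} {c : L →ₗ[F] L →ₗ[F] L} [CharP F p]

namespace IsNormal

lemma eq_zero_of_ev (hc : W.IsNormal c) (hp : p.Prime) {g : L} (hg : ∀ j, c ⁅W.D j, g⁆ = 0)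
    (hω : ∀ k b m, W.ev k (c g (W.e b m)) = 0) : c g = 0 := by
  have key : ∀ N : ℕ, ∀ b m, ∑ t, b t = N → c g (W.e b m) = 0 := by
    intro N
    induction N with
    | zero =>
      intro b m hb
      have : b = 0 := funext fun t => by
        simpa using (sum_eq_zero_iff.1 hb) t (mem_univ t)
      subst this
      have := hc.coc.swap g (W.D m)
      rwa [hc.D, LinearMap.zero_apply, neg_zero] at this
    | succ N ih =>
      intro b m hb
      refine W.eq_zero_of_lie_eq_zero hp _ (fun j => ?_) fun k => hω k b m
      have h1 := LinearMap.congr_fun₂ (hc.coc.lie_eq (W.D j)) g (W.e b m)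
      rw [hc.D, dOne_zero, lie_bilin_apply, hg, lie_D_e] at h1
      by_cases hbj : b j = 0
      · simpa [hbj] using h1
      · have h2 : ∑ t, (b - eps j) t = N := by
          have h3 : b = (b - eps j) + eps j := by
            ext t; simp; split_ifs with h
            · subst h; omega
            · rfl
          rw [h3] at hb
          simp only [Pi.add_apply, sum_add_distrib] at hb
          simpa using hb
        simpa [ih _ m h2] using h1
  refine W.hom_ext fun b m _ => ?_
  rw [key _ b m rfl, LinearMap.zero_apply]

lemma ev_eq_zero_of_target (hc : W.IsNormal c) (hp5 : 5 ≤ p) {i k s : Fin n} {a : Fin n → ℕ}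
    (ha : a ≠ 0) (hak : a k = 0) (hik : i ≠ k) (hsk : s ≠ k) (b : Fin n → ℕ) :
    W.ev k (c (W.e a i) (W.e b s)) = 0 := by
  by_contra hω
  have hb := W.weight_cases hp5 hc.coc hc.h hω k
  rw [if_pos rfl, if_neg hik, if_neg hsk, hak] at hb
  have hbk : b k = p - 1 := by omega
  have hYZ : ⁅W.e (2 • eps k) k, W.e (b - eps k) s⁆ = ((p - 2 : ℕ) : F) • W.e b s := by
    rw [W.lie_e_of_eq b 0
      (by
        intro _ t
        simp only [Pi.sub_apply, Pi.smul_apply, eps_apply, smul_eq_mul]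
        split_ifs with h <;> [(subst h; omega); omega])
      (by intro h; simp [hsk] at h)]
    simp [hsk, hbk, Nat.sub_sub]
  have hgY : ⁅W.e a i, W.e (2 • eps k) k⁆ = 0 := by
    rw [W.lie_e_of_eq 0 0 (by intro h; simp [hik] at h) (by intro h; exact absurd hak h)]
    simp [hik, hak]
  have ⟨r, hr⟩ : ∃ r, a r ≠ 0 := by
    by_contra h; push Not at h; exact ha (funext h)
  have := hc.coc.ev_jac (W.ev k) (x := W.e a i) (y := W.e (2 • eps k) k) (z := W.e (b - eps k) s)
    (W.ev_lie_of_ne_index hik r hr _) (W.ev_lie_of_two_le k k k (by simp) _)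
    (W.ev_lie_of_ne_index hsk k (by simp [hbk]; omega) _)
  rw [hc.sq, hgY, hYZ] at this
  simp only [map_smul, map_zero, add_zero, smul_eq_mul] at this
  exact (mul_ne_zero (natCast_ne_zero_of_lt F p (by omega) (by omega)) hω) this

lemma ev_eq_zero_of_source (hc : W.IsNormal c) (hp5 : 5 ≤ p) {i k s : Fin n} {a : Fin n → ℕ}
    (ha : a ≠ 0) (has : a s = 0) (his : i ≠ s) (hsk : s ≠ k) (b : Fin n → ℕ) :
    W.ev k (c (W.e a i) (W.e b s)) = 0 := by
  by_contra hω
  have hb := W.weight_cases hp5 hc.coc hc.h hω s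
  rw [if_pos rfl, if_neg his, if_neg hsk.symm, has] at hb
  have hbs : b s = 1 := by omega
  have two : (2 : F) ≠ 0 := by
    exact_mod_cast natCast_ne_zero_of_lt F p (k := 2) (by omega) (by omega)
  have hY : (2 • eps s : Fin n → ℕ) ≠ 0 := fun h => by simpa using congrFun h s
  have hYZ : ⁅W.e (2 • eps s) s, W.e (b - eps s) s⁆ = -(2 : F) • W.e b s := by
    rw [W.lie_e_of_eq 0 b (by intro h; simp [hbs] at h)
      (by
        intro _ t
        simp only [Pi.sub_apply, Pi.smul_apply, eps_apply, smul_eq_mul]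
        split_ifs with h <;> [(subst h; omega); omega])]
    simp [hbs]
  have hgY : ⁅W.e a i, W.e (2 • eps s) s⁆ = 0 := by
    rw [W.lie_e_of_eq 0 0 (by intro h; simp [his] at h) (by intro h; exact absurd has h)]
    simp [his, has]
  have hZg : W.ev k (c (W.e (2 • eps s) s) ⁅W.e (b - eps s) s, W.e a i⁆) = 0 := by
    rw [W.lie_e, has]
    simp only [map_sub, map_smul, Nat.cast_zero, zero_smul,
      hc.ev_eq_zero_of_target hp5 hY (k := k) (by simp [hsk.symm]) hsk hsk]
    simp
  by_cases hb0 : b - eps s = 0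
  · have hbe : b = eps s := by
      ext t
      have := congrFun hb0 t
      simp at this ⊢
      split_ifs at this ⊢ with h
      · rw [h, hbs]
      · simpa using this
    apply hω
    rw [hbe, hc.coc.swap, show W.e (eps s) s = W.h s from rfl, hc.h]
    simp
  have ⟨r, hr⟩ : ∃ r, (b - eps s) r ≠ 0 := by
    by_contra h; push Not at h; exact hb0 (funext h)
  have hg : W.ev k ⁅W.e a i, c (W.e (2 • eps s) s) (W.e (b - eps s) s)⁆ = 0 := by
    rw [W.ev_lie k i ha]
    split_ifs
    · rw [neg_eq_zero]
      refine sum_eq_zero fun j _ => ?_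
      split_ifs with h
      · have hjs : s ≠ j := by rintro rfl; simp [h] at has
        exact hc.ev_eq_zero_of_target hp5 hY (by simp [hjs.symm]) hjs hjs _
      · rfl
    · rfl
  have := hc.coc.ev_jac (W.ev k) (x := W.e a i) (y := W.e (2 • eps s) s) (z := W.e (b - eps s) s)
    hg (W.ev_lie_of_two_le k s s (by simp) _) (W.ev_lie_of_ne_index hsk r hr _)
  rw [hZg, hgY, hYZ] at this
  simp only [map_smul, map_zero, add_zero, smul_eq_mul] at this
  exact (mul_ne_zero (neg_ne_zero.2 two) hω) this

end IsNormal

end WittFrame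

end Vanishing

section Vanishing

open Finset

variable {F : Type*} [Field F] {p n : ℕ} {L : Type*} [LieRing L] [LieAlgebra F L]

namespace WittFrame

lemma lie_e_pow (W : WittFrame F p n L) (l : Fin n) {a b m : ℕ} (h : m + 1 = a + b) :
    ⁅W.e (a • eps l) l, W.e (b • eps l) l⁆ = ((b : F) - a) • W.e (m • eps l) l := by
  rw [W.lie_e_of_eq (m • eps l) (m • eps l) (by intro _ r; simp; split_ifs <;> omega)
    (by intro _ r; simp; split_ifs <;> omega)]
  simp [sub_smul]

variable {W : WittFrame F p n L} {c : L →ₗ[F] L →ₗ[F] L} [CharP F p]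

namespace IsNormal

lemma step_self (hc : W.IsNormal c) (l : Fin n) {s : ℕ} (hs : 1 ≤ s) (hsp : s + 3 ≤ p) :
    ((s : F) + 3) * W.ev l (c (W.e ((s + 1) • eps l) l) (W.e ((p - s) • eps l) l)) =
      ((s : F) - 1) *
        W.ev l (c (W.e ((s + 2) • eps l) l) (W.e ((p - (s + 1)) • eps l) l)) := by
  have := hc.coc.ev_jac (W.ev l) (x := W.e (2 • eps l) l) (y := W.e ((s + 1) • eps l) l)
    (z := W.e ((p - (s + 1)) • eps l) l) (W.ev_lie_of_two_le l l l (by simp) _)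
    (W.ev_lie_of_two_le l l l (by simp; omega) _) (W.ev_lie_of_two_le l l l (by simp; omega) _)
  rw [hc.sq, W.lie_e_pow l (m := p - s) (by omega), W.lie_e_pow l (m := s + 2) (by omega),
    hc.coc.swap (W.e ((p - (s + 1)) • eps l) l)] at this
  simp only [map_smul, map_neg, LinearMap.smul_apply, smul_eq_mul] at this
  rw [Nat.cast_sub (by omega), CharP.cast_eq_zero F p] at this
  push_cast at this
  linear_combination this

lemma ev_two_self (hc : W.IsNormal c) (hp5 : 5 ≤ p) (l : Fin n) :
    W.ev l (c (W.e (3 • eps l) l) (W.e ((p - 2) • eps l) l)) = 0 := by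
  have key : ∀ s, 2 ≤ s → s + 3 ≤ p →
      24 * W.ev l (c (W.e ((s + 1) • eps l) l) (W.e ((p - s) • eps l) l)) =
        ((s : F) + 2) * (s + 1) * s * (s - 1) *
          W.ev l (c (W.e (3 • eps l) l) (W.e ((p - 2) • eps l) l)) := by
    intro s hs
    induction s, hs using Nat.le_induction with
    | base => intro _; norm_num
    | succ s hs ih =>
      intro hsp
      have h1 := ih (by omega)
      have h2 := hc.step_self l (show 1 ≤ s by omega) (show s + 3 ≤ p by omega)
      have h3 : (s : F) - 1 ≠ 0 := by
        rw [← Nat.cast_one, ← Nat.cast_sub (by omega)]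
        exact natCast_ne_zero_of_lt F p (by omega) (by omega)
      refine mul_left_cancel₀ h3 ?_
      push_cast
      linear_combination (-24) * h2 + ((s : F) + 3) * h1
  have h1 := key (p - 3) (by omega) (by omega)
  rw [show p - 3 + 1 = p - 2 by omega, show p - (p - 3) = 3 by omega, hc.coc.swap,
    Nat.cast_sub (by omega), CharP.cast_eq_zero F p] at h1
  have two : ((2 : ℕ) : F) ≠ 0 := natCast_ne_zero_of_lt F p (by omega) (by omega)
  have three : ((3 : ℕ) : F) ≠ 0 := natCast_ne_zero_of_lt F p (by omega) (by omega)
  have h2 := mul_ne_zero (pow_ne_zero 4 two) three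
  refine (mul_eq_zero.1 ?_).resolve_left h2
  push_cast at h1 ⊢
  rw [map_neg] at h1
  linear_combination -h1

lemma ev_three_self (hc : W.IsNormal c) (hp5 : 5 ≤ p) (l : Fin n) :
    W.ev l (c (W.e (4 • eps l) l) (W.e ((p - 3) • eps l) l)) = 0 := by
  have := hc.step_self l (s := 2) (by omega) (by omega)
  rw [hc.ev_two_self hp5] at this
  rw [mul_zero, show ((2 : ℕ) : F) - 1 = 1 by norm_num, one_mul] at this
  exact this.symm

lemma ev_pow_target (hc : W.IsNormal c) (hp5 : 5 ≤ p) {l t : Fin n} (hlt : l ≠ t) {q : ℕ}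
    (hq : q + 2 < p)
    (hA : W.ev l (c (W.e ((q + 2) • eps l) l) (W.e ((p - 1 - q) • eps l) l)) = 0) :
    W.ev t (c (W.e ((q + 2) • eps l) l) (W.e ((p - 1 - q) • eps l) t)) =
      -((q : F) + 2) *
        W.ev l (c (W.e ((q + 1) • eps l + eps t) l) (W.e ((p - 1 - q) • eps l) t)) := by
  have hY : ((q + 2) • eps l : Fin n → ℕ) ≠ 0 := fun h => by simpa using congrFun h l
  have hYZ : ⁅W.e ((q + 2) • eps l) l, W.e ((p - 1 - q) • eps l) t⁆ = 0 := by
    rw [W.lie_e_of_eq (p • eps l) 0 (by intro _ r; simp; split_ifs <;> omega)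
      (by intro h; simp [hlt.symm] at h), W.e_eq_zero (p • eps l) t l (by simp)]
    simp [hlt.symm]
  have hZX : ⁅W.e ((p - 1 - q) • eps l) t, W.e (eps t) l⁆ = W.e ((p - 1 - q) • eps l) l -
      ((p - 1 - q : ℕ) : F) • W.e ((p - 2 - q) • eps l + eps t) t := by
    rw [W.lie_e_of_eq ((p - 1 - q) • eps l) ((p - 2 - q) • eps l + eps t)
      (by intro _ r; simp) (by intro _ r; simp; split_ifs <;> omega)]
    simp
  have hXY : ⁅W.e (eps t) l, W.e ((q + 2) • eps l) l⁆ =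
      ((q : F) + 2) • W.e ((q + 1) • eps l + eps t) l := by
    rw [W.lie_e_of_eq ((q + 1) • eps l + eps t) 0
      (by intro _ r; simp; split_ifs <;> omega) (by intro h; simp [hlt] at h)]
    simp [hlt]
  have := congrArg (W.ev l) (hc.coc.jac (W.e (eps t) l) (W.e ((q + 2) • eps l) l)
    (W.e ((p - 1 - q) • eps l) t))
  rw [hYZ, hZX, hXY, map_smul (c (W.e ((p - 1 - q) • eps l) t)), hc.coc.swap _ (W.e (_ + _) l)]
    at this
  simp only [map_add, map_sub, map_zero, map_smul, map_neg, smul_neg, W.ev_lie_eps, if_true, hA,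
    W.ev_lie_of_two_le l l (a := (q + 2) • eps l) l (by simp),
    W.ev_lie_of_ne_index hlt.symm (a := (p - 1 - q) • eps l) l (by simp; omega),
    hc.ev_eq_zero_of_source hp5 hY (s := t) (k := l) (by simp [hlt.symm]) hlt hlt.symm,
    smul_eq_mul] at this
  linear_combination -this

lemma ev_mixed (hc : W.IsNormal c) (hp5 : 5 ≤ p) {l t : Fin n} (hlt : l ≠ t) {q : ℕ}
    (hq : 1 ≤ q) (hqp : q + 1 < p)
    (hA : W.ev l (c (W.e ((q + 1) • eps l) l) (W.e ((p - q) • eps l) l)) = 0) :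
    (q : F) * W.ev l (c (W.e ((q + 1) • eps l + eps t) l) (W.e ((p - 1 - q) • eps l) t)) +
      ((q : F) + 1) * W.ev l (c (W.e (eps l + eps t) l) (W.e ((p - 1) • eps l) t)) = 0 := by
  have hX : ((q + 1) • eps l : Fin n → ℕ) ≠ 0 := fun h => by simpa using congrFun h l
  have hYZ : ⁅W.e (eps l + eps t) l, W.e ((p - 1 - q) • eps l) t⁆ =
      ((p - 1 - q : ℕ) : F) • W.e ((p - 1 - q) • eps l + eps t) t - W.e ((p - q) • eps l) l := by
    rw [W.lie_e_of_eq ((p - 1 - q) • eps l + eps t) ((p - q) • eps l)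
      (by intro _ r; simp; split_ifs <;> omega) (by intro _ r; simp; split_ifs <;> omega)]
    simp [hlt.symm]
  have hZX : ⁅W.e ((p - 1 - q) • eps l) t, W.e ((q + 1) • eps l) l⁆ =
      ((q : F) + 1) • W.e ((p - 1) • eps l) t := by
    rw [W.lie_e_of_eq 0 ((p - 1) • eps l) (by intro h; simp [hlt.symm] at h)
      (by intro _ r; simp; split_ifs <;> omega)]
    have : ((p - 1 - q : ℕ) : F) = -((q : F) + 1) := by
      rw [Nat.sub_sub, Nat.cast_sub (by omega), CharP.cast_eq_zero F p]
      push_cast; ring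
    simp only [Pi.smul_apply, eps_apply, if_true, hlt.symm, if_false, mul_zero, Nat.cast_zero,
      zero_smul, zero_sub, smul_eq_mul, mul_one, this, neg_smul, neg_neg]
  have hXY : ⁅W.e ((q + 1) • eps l) l, W.e (eps l + eps t) l⁆ =
      -(q : F) • W.e ((q + 1) • eps l + eps t) l := by
    rw [W.lie_e_of_eq ((q + 1) • eps l + eps t) ((q + 1) • eps l + eps t)
      (by intro _ r; simp; split_ifs <;> omega) (by intro _ r; simp; split_ifs <;> omega),
      ← sub_smul]
    simp [hlt]
  have := hc.coc.ev_jac (W.ev l) (W.ev_lie_of_two_le l l (a := (q + 1) • eps l) l (by simp; omega) _)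
    (W.ev_lie_of_one_le l l (a := eps l + eps t) hlt (by simp) (by simp) _)
    (W.ev_lie_of_ne_index hlt.symm (a := (p - 1 - q) • eps l) l (by simp; omega) _)
  rw [hYZ, hZX, hXY, map_smul (c (W.e ((p - 1 - q) • eps l) t)),
    hc.coc.swap _ (W.e ((q + 1) • eps l + eps t) l)] at this
  simp only [map_sub, map_smul, map_neg, smul_neg, hA,
    hc.ev_eq_zero_of_source hp5 hX (s := t) (k := l) (by simp [hlt.symm]) hlt hlt.symm,
    smul_eq_mul] at this
  linear_combination this

lemma ev_mixed_zero (hc : W.IsNormal c) (hp5 : 5 ≤ p) {l t : Fin n} (hlt : l ≠ t) :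
    W.ev l (c (W.e (eps l + eps t) l) (W.e ((p - 1) • eps l) t)) = 0 ∧
    W.ev t (c (W.e (2 • eps l) l) (W.e ((p - 1) • eps l) t)) = 0 ∧
    W.ev t (c (W.e (3 • eps l) l) (W.e ((p - 2) • eps l) t)) = 0 := by
  have b1 := hc.ev_pow_target hp5 hlt (q := 0) (by omega) (hc.sq l _)
  have b2 := hc.ev_pow_target hp5 hlt (q := 1) (by omega) (hc.ev_two_self hp5 l)
  have b3 := hc.ev_pow_target hp5 hlt (q := 2) (by omega) (hc.ev_three_self hp5 l)
  have k1 := hc.ev_mixed hp5 hlt (q := 1) (by omega) (by omega) (hc.sq l _)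
  have k2 := hc.ev_mixed hp5 hlt (q := 2) (by omega) (by omega) (hc.ev_two_self hp5 l)
  simp only [Nat.reduceAdd, Nat.sub_sub, zero_add, add_zero, one_smul, Nat.cast_zero, Nat.cast_one,
    Nat.cast_ofNat] at b1 b2 b3 k1 k2
  have hYZ : ⁅W.e (3 • eps l) l, W.e ((p - 3) • eps l) t⁆ =
      ((p - 3 : ℕ) : F) • W.e ((p - 1) • eps l) t := by
    rw [W.lie_e_of_eq ((p - 1) • eps l) 0 (by intro _ r; simp; split_ifs <;> omega)
      (by intro h; simp [hlt.symm] at h)]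
    simp [hlt.symm]
  have hZX : ⁅W.e ((p - 3) • eps l) t, W.e (2 • eps l) l⁆ =
      -(((p - 3 : ℕ) : F) • W.e ((p - 2) • eps l) t) := by
    rw [W.lie_e_of_eq 0 ((p - 2) • eps l) (by intro h; simp [hlt.symm] at h)
      (by intro _ r; simp; split_ifs <;> omega)]
    simp [hlt.symm]
  have h3 := hc.coc.ev_jac (W.ev t) (W.ev_lie_of_two_le t l (a := 2 • eps l) l (by simp) _)
    (W.ev_lie_of_two_le t l (a := 3 • eps l) l (by simp) _)
    (W.ev_lie_of_two_le t t (a := (p - 3) • eps l) l (by simp; omega) _)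
  rw [hYZ, hZX, W.lie_e_pow l (a := 2) (b := 3) (m := 4) rfl, map_smul (c (W.e ((p - 3) • eps l) t)),
    hc.coc.swap _ (W.e (4 • eps l) l), Nat.cast_sub (by omega), CharP.cast_eq_zero F p] at h3
  simp only [map_smul, map_neg, smul_neg, smul_eq_mul] at h3
  push_cast at h3
  have two : ((2 : ℕ) : F) ≠ 0 := natCast_ne_zero_of_lt F p (by omega) (by omega)
  have three : ((3 : ℕ) : F) ≠ 0 := natCast_ne_zero_of_lt F p (by omega) (by omega)
  have K0 : W.ev l (c (W.e (eps l + eps t) l) (W.e ((p - 1) • eps l) t)) = 0 := by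
    refine (mul_eq_zero.1 ?_).resolve_left (mul_ne_zero two (mul_ne_zero three three))
    push_cast
    linear_combination h3 + 3 * b1 - 3 * b2 + b3 + 9 * k1 - 2 * k2
  rw [K0] at b1 k1
  refine ⟨K0, ?_, ?_⟩
  · rw [b1]; ring
  · linear_combination b2 - 3 * k1

end IsNormal

end WittFrame

end Vanishing

section Vanishing

open Finset

variable {F : Type*} [Field F] {p n : ℕ} {L : Type*} [LieRing L] [LieAlgebra F L]

namespace WittFrame

namespace IsNormal

variable {W : WittFrame F p n L} {c : L →ₗ[F] L →ₗ[F] L} [CharP F p]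

lemma apply_sq (hc : W.IsNormal c) (hp : p.Prime) (hp5 : 5 ≤ p) (l : Fin n) :
    c (W.e (2 • eps l) l) = 0 := by
  have h0 : (2 • eps l : Fin n → ℕ) ≠ 0 := fun h => by simpa using congrFun h l
  refine hc.eq_zero_of_ev hp (fun j => ?_) fun k b m => ?_
  · rw [lie_D_e, map_smul]
    by_cases hj : j = l
    · subst hj
      rw [show 2 • eps j - eps j = eps j by rw [two_nsmul, add_tsub_cancel_right]]
      rw [show W.e (eps j) j = W.h j from rfl, hc.h, smul_zero]
    · simp [hj]
  · by_cases hk : l = k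
    · subst hk; exact hc.sq l _
    by_cases hm : m = k
    · subst hm
      by_contra hω
      have hb := W.weight_cases hp5 hc.coc hc.h hω
      have : b = (p - 1) • eps l := by
        ext t
        have := hb t
        simp only [Pi.smul_apply, eps_apply, smul_eq_mul] at this ⊢
        by_cases htl : t = l
        · subst htl; simp [Ne.symm hk] at this ⊢; omega
        · by_cases htm : t = m
          · subst htm; simp [htl, Ne.symm htl] at this ⊢; omega
          · simp [Ne.symm htm, htl, Ne.symm htl] at this ⊢; omega
      rw [this] at hω
      exact hω (hc.ev_mixed_zero hp5 hk).2.1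
    · exact hc.ev_eq_zero_of_target hp5 h0 (by simp [Ne.symm hk]) hk hm b

lemma apply_cube (hc : W.IsNormal c) (hp : p.Prime) (hp5 : 5 ≤ p) (l : Fin n) :
    c (W.e (3 • eps l) l) = 0 := by
  have h0 : (3 • eps l : Fin n → ℕ) ≠ 0 := fun h => by simpa using congrFun h l
  refine hc.eq_zero_of_ev hp (fun j => ?_) fun k b m => ?_
  · rw [lie_D_e, map_smul]
    by_cases hj : j = l
    · subst hj
      rw [show 3 • eps j - eps j = 2 • eps j by
        rw [show 3 = 2 + 1 from rfl, succ_nsmul, add_tsub_cancel_right]]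
      rw [hc.apply_sq hp hp5, smul_zero]
    · simp [hj]
  · by_cases hk : l = k
    · subst hk
      by_cases hm : m = l
      · subst hm
        by_contra hω
        have hb := W.weight_cases hp5 hc.coc hc.h hω
        have : b = (p - 2) • eps m := by
          ext t
          have := hb t
          simp only [Pi.smul_apply, eps_apply, smul_eq_mul] at this ⊢
          by_cases htm : t = m
          · subst htm; simp at this ⊢; omega
          · simp [htm, Ne.symm htm] at this ⊢; omega
        rw [this] at hω
        exact hω (hc.ev_two_self hp5 m)
      · exact hc.ev_eq_zero_of_source hp5 h0 (by simp [hm]) (Ne.symm hm) hm b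
    by_cases hm : m = k
    · subst hm
      by_contra hω
      have hb := W.weight_cases hp5 hc.coc hc.h hω
      have : b = (p - 2) • eps l := by
        ext t
        have := hb t
        simp only [Pi.smul_apply, eps_apply, smul_eq_mul] at this ⊢
        by_cases htl : t = l
        · subst htl; simp [Ne.symm hk] at this ⊢; omega
        · by_cases htm : t = m
          · subst htm; simp [htl, Ne.symm htl] at this ⊢; omega
          · simp [Ne.symm htm, htl, Ne.symm htl] at this ⊢; omega
      rw [this] at hω
      exact hω (hc.ev_mixed_zero hp5 hk).2.2
    · exact hc.ev_eq_zero_of_target hp5 h0 (by simp [Ne.symm hk]) hk hm b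

lemma apply_pow (hc : W.IsNormal c) (hp : p.Prime) (hp5 : 5 ≤ p) (l : Fin n) {r : ℕ}
    (hr : 3 ≤ r) : c (W.e (r • eps l) l) = 0 := by
  induction r, hr using Nat.le_induction with
  | base => exact hc.apply_cube hp hp5 l
  | succ r hr ih =>
    by_cases hrp : p ≤ r
    · rw [W.e_eq_zero _ l l (by simp; omega), map_zero]
    have h1 : ⁅W.e (2 • eps l) l, W.e (r • eps l) l⁆ ∈ hc.coc.radical :=
      LieSubalgebra.lie_mem _ (hc.coc.mem_radical.2 (hc.apply_sq hp hp5 l))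
        (hc.coc.mem_radical.2 ih)
    rw [W.lie_e_pow l (m := r + 1) (by omega), hc.coc.mem_radical, map_smul] at h1
    refine (smul_eq_zero.1 h1).resolve_left ?_
    rw [← Nat.cast_sub (by omega)]
    exact natCast_ne_zero_of_lt F p (by omega) (by omega)

lemma ev_mixed_last (hc : W.IsNormal c) (hp : p.Prime) (hp5 : 5 ≤ p) {l t : Fin n}
    (hlt : l ≠ t) : W.ev l (c (W.e ((p - 1) • eps l + eps t) l) (W.e (eps l) t)) = 0 := by
  have h1 := hc.ev_mixed hp5 hlt (q := p - 2) (by omega) (by omega)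
    (by rw [hc.apply_pow hp hp5 l (by omega)]; simp)
  rw [(hc.ev_mixed_zero hp5 hlt).1, mul_zero, add_zero] at h1
  have h2 := (mul_eq_zero.1 h1).resolve_left (natCast_ne_zero_of_lt F p (by omega) (by omega))
  rwa [show p - 2 + 1 = p - 1 by omega, show p - 1 - (p - 2) = 1 by omega, one_smul] at h2

lemma ev_cross_zero (hc : W.IsNormal c) (hp : p.Prime) (hp5 : 5 ≤ p) {l t : Fin n}
    (hlt : l ≠ t) :
    W.ev t (c (W.e (eps l + eps t) t) (W.e ((p - 1) • eps l) t)) = 0 ∧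
    W.ev t (c (W.e ((p - 1) • eps l + eps t) t) (W.e (eps l) t)) = 0 := by
  have e1 : c (W.e ((p - 1) • eps l) l) = 0 := hc.apply_pow hp hp5 l (by omega)
  have e2 := hc.apply_sq hp hp5 t
  have r1 := hc.coc.ev_jac (W.ev t) (x := W.e ((p - 1) • eps l) l) (y := W.e (eps l + eps t) t)
    (z := W.e (eps l) t) (W.ev_lie_of_two_le t l l (by simp; omega) _)
    (by rw [hc.coc.swap, e1]; simp) (by rw [e1]; simp)
  have r2 := hc.coc.ev_jac (W.ev t) (x := W.e (2 • eps t) t) (y := W.e (eps l) t)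
    (z := W.e ((p - 1) • eps l) t) (W.ev_lie_of_two_le t t t (by simp) _)
    (by rw [hc.coc.swap, e2]; simp) (by rw [e2]; simp)
  have b1 : ⁅W.e (eps l) t, W.e ((p - 1) • eps l) l⁆ = -W.e ((p - 1) • eps l) t := by
    rw [W.lie_e_of_eq 0 ((p - 1) • eps l) (by intro h; simp [hlt.symm] at h)
      (by intro _ r; simp; split_ifs <;> omega)]
    simp [hlt.symm]
  have b2 : ⁅W.e ((p - 1) • eps l) l, W.e (eps l + eps t) t⁆ =
      W.e ((p - 1) • eps l + eps t) t := by
    rw [W.lie_e_of_eq ((p - 1) • eps l + eps t) 0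
      (by intro _ r; simp; split_ifs <;> omega) (by intro h; simp [hlt.symm] at h)]
    simp [hlt, hlt.symm]
  have b3 : ⁅W.e ((p - 1) • eps l) t, W.e (2 • eps t) t⁆ =
      (2 : F) • W.e ((p - 1) • eps l + eps t) t := by
    rw [W.lie_e_of_eq ((p - 1) • eps l + eps t) 0
      (by intro _ r; simp; split_ifs <;> omega) (by intro h; simp [hlt.symm] at h)]
    simp [hlt.symm]
  have b4 : ⁅W.e (2 • eps t) t, W.e (eps l) t⁆ = -(2 : F) • W.e (eps l + eps t) t := by
    rw [W.lie_e_of_eq 0 (eps l + eps t) (by intro h; simp [hlt.symm] at h)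
      (by intro _ r; simp; split_ifs <;> omega)]
    simp [hlt.symm]
  rw [e1, b1, b2, hc.coc.swap (W.e (eps l) t)] at r1
  rw [e2, b3, b4, map_smul, map_smul, hc.coc.swap (W.e (eps l) t),
    hc.coc.swap (W.e ((p - 1) • eps l) t)] at r2
  simp only [map_neg, map_smul, LinearMap.smul_apply, LinearMap.zero_apply, map_zero, zero_add,
    smul_eq_mul] at r1 r2
  have two : ((2 : ℕ) : F) ≠ 0 := natCast_ne_zero_of_lt F p (by omega) (by omega)
  have h1 : W.ev t (c (W.e (eps l + eps t) t) (W.e ((p - 1) • eps l) t)) = 0 := by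
    refine (mul_eq_zero.1 ?_).resolve_left (mul_ne_zero two two)
    push_cast
    linear_combination r2 - 2 * r1
  rw [h1] at r1
  exact ⟨h1, by linear_combination -r1⟩

lemma apply_linear (hc : W.IsNormal c) (hp : p.Prime) (hp5 : 5 ≤ p) {l s : Fin n}
    (hls : l ≠ s) : c (W.e (eps l) s) = 0 := by
  have hpc : ((p - 1 : ℕ) : F) = -1 := by
    rw [Nat.cast_sub (by omega), CharP.cast_eq_zero F p]; simp
  refine hc.eq_zero_of_ev hp (fun j => ?_) fun k b m => ?_
  · rw [lie_D_e, map_smul]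
    by_cases hj : j = l
    · subst hj
      rw [tsub_self, show W.e 0 s = W.D s from rfl, hc.D, smul_zero]
    · simp [hj]
  have g0 := eps_ne_zero l
  by_cases hmk : m = k
  swap
  · by_cases hml : m = l
    · by_cases hks : k = s
      · subst hml hks
        by_contra hω
        have hb := W.weight_cases hp5 hc.coc hc.h hω
        have : b = 0 := by
          ext t
          have := hb t
          simp only [eps_apply, Pi.zero_apply] at this ⊢
          by_cases htl : t = m
          · subst htl; simp [hls.symm] at this ⊢; omega
          · by_cases htm : t = k
            · subst htm; simp [htl, Ne.symm htl] at this ⊢; omega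
            · simp [Ne.symm htm, htl, Ne.symm htl] at this ⊢; omega
        subst this
        apply hω
        rw [hc.coc.swap, show W.e 0 m = W.D m from rfl, hc.D]; simp
      · subst hml
        exact hc.ev_eq_zero_of_target hp5 g0 (by simp [Ne.symm hmk]) (Ne.symm hks) hmk b
    · by_cases hms : m = s
      swap
      · exact hc.ev_eq_zero_of_source hp5 g0 (by simp [hml]) (Ne.symm hms) hmk b
      by_cases hkl : k = l
      swap
      · exact hc.ev_eq_zero_of_target hp5 g0 (by simp [hkl]) (by rwa [← hms]) hmk b
      subst hms hkl
      by_contra hω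
      have hb := W.weight_cases hp5 hc.coc hc.h hω
      have : b = (p - 2) • eps k + 2 • eps m := by
        ext t
        have := hb t
        simp only [Pi.add_apply, Pi.smul_apply, eps_apply, smul_eq_mul] at this ⊢
        by_cases htl : t = k
        · subst htl; simp [hls, hls.symm] at this ⊢; omega
        · by_cases htm : t = m
          · subst htm; simp [htl, Ne.symm htl] at this ⊢; omega
          · simp [htm, Ne.symm htm, htl, Ne.symm htl] at this ⊢; omega
      subst this
      apply hω
      have b1 : ⁅W.e (eps k) m, W.e ((p - 1) • eps k) m⁆ = 0 := by
        rw [W.lie_e_of_eq 0 0 (by intro h; simp [hls.symm] at h)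
          (by intro h; simp [hls.symm] at h)]
        simp [hls.symm]
      have b2 : ⁅W.e ((p - 1) • eps k) m, W.e (2 • eps m) k⁆ =
          (2 : F) • W.e ((p - 1) • eps k + eps m) k +
            W.e ((p - 2) • eps k + 2 • eps m) m := by
        rw [W.lie_e_of_eq ((p - 1) • eps k + eps m) ((p - 2) • eps k + 2 • eps m)
          (by intro _ r; simp; split_ifs <;> omega) (by intro _ r; simp; split_ifs <;> omega)]
        simp [hpc]
      have b3 : ⁅W.e (2 • eps m) k, W.e (eps k) m⁆ =
          W.e (2 • eps m) m - (2 : F) • W.e (eps k + eps m) k := by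
        rw [W.lie_e_of_eq (2 • eps m) (eps k + eps m)
          (by intro _ r; simp) (by intro _ r; simp; split_ifs <;> omega)]
        simp
      have r := hc.coc.ev_jac (W.ev k) (x := W.e (2 • eps m) k) (y := W.e (eps k) m)
        (z := W.e ((p - 1) • eps k) m) (W.ev_lie_of_two_le k k m (by simp) _)
        (W.ev_lie_of_ne_index hmk k (by simp) _) (W.ev_lie_of_ne_index hmk k (by simp; omega) _)
      rw [b1, b2, b3, map_add, map_sub, map_smul, map_smul,
        hc.coc.swap _ (W.e ((p - 1) • eps k + eps m) k), hc.coc.swap _ (W.e (2 • eps m) m),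
        hc.coc.swap _ (W.e (eps k + eps m) k), hc.apply_sq hp hp5] at r
      simp only [map_neg, map_add, map_sub, map_smul, map_zero, LinearMap.zero_apply,
        smul_eq_mul] at r
      linear_combination r + 2 * hc.ev_mixed_last hp hp5 hls - 2 * (hc.ev_mixed_zero hp5 hls).1
  subst hmk
  by_cases hms : m = s
  · subst hms
    by_contra hω
    have hb := W.weight_cases hp5 hc.coc hc.h hω
    have : b = (p - 1) • eps l + eps m := by
      ext t
      have := hb t
      simp only [Pi.add_apply, Pi.smul_apply, eps_apply, smul_eq_mul] at this ⊢
      by_cases htl : t = l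
      · subst htl; simp [hls, hls.symm] at this ⊢; omega
      · by_cases htm : t = m
        · subst htm; simp [htl] at this ⊢; omega
        · simp [htm, Ne.symm htm, htl] at this ⊢; omega
    subst this
    apply hω
    rw [hc.coc.swap, map_neg, (hc.ev_cross_zero hp hp5 hls).2, neg_zero]
  by_cases hml : m = l
  · subst hml
    by_contra hω
    have hb := W.weight_cases hp5 hc.coc hc.h hω
    have : b = (p - 1) • eps m + eps s := by
      ext t
      have := hb t
      simp only [Pi.add_apply, Pi.smul_apply, eps_apply, smul_eq_mul] at this ⊢
      by_cases htl : t = m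
      · subst htl; simp [hls, hls.symm] at this ⊢; omega
      · by_cases htm : t = s
        · subst htm; simp [htl, Ne.symm htl] at this ⊢; omega
        · simp [htm, Ne.symm htm, htl, Ne.symm htl] at this ⊢; omega
    subst this
    apply hω
    rw [hc.coc.swap, map_neg, hc.ev_mixed_last hp hp5 hls, neg_zero]
  by_contra hω
  have hb := W.weight_cases hp5 hc.coc hc.h hω
  have : b = (p - 1) • eps l + eps s := by
    ext t
    have := hb t
    simp only [Pi.add_apply, Pi.smul_apply, eps_apply, smul_eq_mul] at this ⊢
    by_cases htl : t = l
    · subst htl; simp [hls, hls.symm, hml] at this ⊢; omega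
    · by_cases hts : t = s
      · subst hts; simp [htl, hms] at this ⊢; omega
      · simp [hts, Ne.symm hts, htl] at this ⊢; omega
  subst this
  apply hω
  have b1 : ⁅W.e (eps l) s, W.e ((p - 1) • eps l) m⁆ = 0 := by
    rw [W.lie_e_of_eq 0 0 (by intro h; simp [hls.symm] at h) (by intro h; simp [hml] at h)]
    simp [hls.symm, hml]
  have b2 : ⁅W.e ((p - 1) • eps l) m, W.e (eps s + eps m) m⁆ =
      W.e ((p - 1) • eps l + eps s) m := by
    rw [W.lie_e_of_eq ((p - 1) • eps l + eps s) 0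
      (by intro _ r; simp; split_ifs <;> omega) (by intro h; simp [hml] at h)]
    simp [hml, hms]
  have b3 : ⁅W.e (eps s + eps m) m, W.e (eps l) s⁆ = -W.e (eps l + eps m) m := by
    rw [W.lie_e_of_eq 0 (eps l + eps m) (by intro h; simp [hml] at h)
      (by intro _ r; simp; split_ifs <;> omega)]
    simp [hml, Ne.symm hms]
  have r := hc.coc.ev_jac (W.ev m) (x := W.e (eps s + eps m) m) (y := W.e (eps l) s)
    (z := W.e ((p - 1) • eps l) m)
    (W.ev_lie_of_one_le m m (s := s) (t := m) (Ne.symm hms) (by simp) (by simp) _)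
    (W.ev_lie_of_ne_index (Ne.symm hms) l (by simp) _)
    (W.ev_lie_of_two_le m m l (by simp; omega) _)
  rw [b1, b2, b3, map_neg, hc.coc.swap _ (W.e (eps l + eps m) m)] at r
  simp only [map_zero, neg_neg] at r
  linear_combination r - (hc.ev_cross_zero hp hp5 (Ne.symm hml)).1

/-- A normalized cocycle vanishes. -/
theorem eq_zero (hc : W.IsNormal c) (hp : p.Prime) (hp5 : 5 ≤ p) : c = 0 := by
  ext x : 1
  refine hc.coc.mem_radical.1 (mem_of_generators (S := hc.coc.radical) hp5 (fun j i => ?_)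
    (fun i => hc.apply_sq hp hp5 i) (fun i => hc.D i) (fun i => hc.apply_cube hp hp5 i) x)
  by_cases h : j = i
  · subst h; exact hc.h j
  · exact hc.apply_linear hp hp5 h

end IsNormal

end WittFrame

end Vanishing

section FrameTheorem

open Finset

variable {F : Type*} [Field F] {p n : ℕ} {L : Type*} [LieRing L] [LieAlgebra F L]

/-- A cocycle, as a bilinear map. -/
lemma IsLieCocycle2.exists_isCoc {c : L → L → L} (hc : IsLieCocycle2 F c) :
    ∃ b : L →ₗ[F] L →ₗ[F] L, IsCoc b ∧ ∀ x y, b x y = c x y := by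
  obtain ⟨h1, h2, h3, h4⟩ := hc
  have z1 : ∀ y, c 0 y = 0 := fun y => by simpa using h1 1 0 0 y
  have z2 : ∀ x, c x 0 = 0 := fun x => by simpa using h2 1 x 0 0
  refine ⟨LinearMap.mk₂ F c (fun x x' y => by simpa using h1 1 x x' y)
    (fun t x y => by simpa [z1] using h1 t x 0 y) (fun x y y' => by simpa using h2 1 x y y')
    (fun t x y => by simpa [z2] using h2 t x y 0), ⟨fun x => ?_, fun x y z => ?_⟩, fun x y => rfl⟩
  · exact h3 x
  · exact h4 x y z

lemma IsCoc.zero : IsCoc (0 : L →ₗ[F] L →ₗ[F] L) := ⟨fun x => by simp, fun x y z => by simp⟩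

lemma IsCoc.smul {c : L →ₗ[F] L →ₗ[F] L} (hc : IsCoc c) (t : F) : IsCoc (t • c) :=
  ⟨fun x => by simp [hc.alt x], fun x y z => by
    simpa only [LinearMap.smul_apply, lie_smul, ← smul_add, smul_zero]
      using congrArg (t • ·) (hc.jac x y z)⟩

lemma IsCoc.sum {ι : Type*} (s : Finset ι) {c : ι → L →ₗ[F] L →ₗ[F] L} (hc : ∀ i, IsCoc (c i)) :
    IsCoc (∑ i ∈ s, c i) :=
  Finset.sum_induction _ IsCoc (fun _ _ h h' => h.add h') IsCoc.zero fun i _ => hc i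

lemma isLieCocycle2_sqCochain_lie [CharP F p] (hp : p.Prime) (hp5 : 5 ≤ p) (x : L) :
    IsLieCocycle2 F (sqCochain F p fun z : L => ⁅x, z⁆) := by
  have h2 : (2 : F) ≠ 0 := by
    exact_mod_cast natCast_ne_zero_of_lt F p (k := 2) (by omega) (by omega)
  have := isLieCocycle2_sqCochain p hp h2 (LieDerivation.ad F L x)
  rwa [show ⇑(LieDerivation.ad F L x) = fun z => ⁅x, z⁆ from funext fun z => by simp] at this

namespace WittFrame

variable [CharP F p] (W : WittFrame F p n L)

/-- A cocycle annihilated by the functionals `c ↦ ev_l c(x_l² D_l, x_l^{p-1} D_l)` is a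
coboundary. -/
lemma exists_eq_dOne (hp : p.Prime) (hp5 : 5 ≤ p) {c : L →ₗ[F] L →ₗ[F] L} (hc : IsCoc c)
    (hΦ : ∀ l, W.ev l (c (W.e (2 • eps l) l) (W.e ((p - 1) • eps l) l)) = 0) :
    ∃ g, c = dOne g := by
  obtain ⟨g₁, hD, hh⟩ := W.exists_normalize hp hp5 hc
  have hc₁ := hc.sub (IsCoc.dOne g₁)
  obtain ⟨g₂, hD₂, hh₂, hsq⟩ := W.exists_normalize_sq hp hp5 hc₁ hD hh fun l => by
    rw [LinearMap.sub_apply, LinearMap.sub_apply, map_sub, hΦ, W.ev_dOne_sq hp5, sub_zero]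
  have h0 : c - dOne g₁ - dOne g₂ = 0 :=
    IsNormal.eq_zero (W := W) ⟨hc₁.sub (IsCoc.dOne g₂), hD₂, hh₂, hsq⟩ hp hp5
  exact ⟨g₁ + g₂, by rw [dOne_add, ← sub_eq_zero, ← h0]; abel⟩

lemma ev_sum_sqCochain (hp : p.Prime) (hp5 : 5 ≤ p) (l : Fin n) (a : Fin n → F) :
    W.ev l ((∑ i, a i • sqCochain F p (fun z => ⁅W.D i, z⁆) : L → L → L)
      (W.e (2 • eps l) l) (W.e ((p - 1) • eps l) l)) = a l * -3 := by
  simp only [Finset.sum_apply, Pi.smul_apply, map_sum, map_smul, W.ev_sqCochain hp hp5,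
    smul_eq_mul, mul_ite, mul_zero, Finset.sum_ite_eq', Finset.mem_univ, if_true]

lemma exists_isLieCoboundary2_sub (hp : p.Prime) (hp5 : 5 ≤ p) {c : L → L → L}
    (hc : IsLieCocycle2 F c) : ∃ a : Fin n → F,
      IsLieCoboundary2 F (c - ∑ i, a i • sqCochain F p (fun z => ⁅W.D i, z⁆)) := by
  have h3 : (3 : F) ≠ 0 := by
    exact_mod_cast natCast_ne_zero_of_lt F p (k := 3) (by omega) (by omega)
  obtain ⟨b, hb, hbc⟩ := hc.exists_isCoc
  choose S hS hSq using fun i =>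
    (isLieCocycle2_sqCochain_lie (F := F) hp hp5 (W.D i)).exists_isCoc
  let a : Fin n → F := fun l => W.ev l (b (W.e (2 • eps l) l) (W.e ((p - 1) • eps l) l)) * (-3)⁻¹
  have hab : ∀ x y, (b - ∑ i, a i • S i) x y =
      (c - ∑ i, a i • sqCochain F p (fun z => ⁅W.D i, z⁆) : L → L → L) x y := fun x y => by
    simp [hbc, hSq, Finset.sum_apply]
  obtain ⟨g, hg⟩ := W.exists_eq_dOne hp hp5
    (hb.sub (IsCoc.sum univ fun i => (hS i).smul (a i))) fun l => by
      rw [hab, Pi.sub_apply, Pi.sub_apply, map_sub, W.ev_sum_sqCochain hp hp5, ← hbc,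
        inv_mul_cancel_right₀ (neg_ne_zero.2 h3), sub_self]
  exact ⟨a, g, fun x y => by rw [← hab, hg, dOne_apply]⟩

lemma eq_zero_of_isLieCoboundary2 (hp : p.Prime) (hp5 : 5 ≤ p) {a : Fin n → F}
    (h : IsLieCoboundary2 F (∑ i, a i • sqCochain F p (fun z => ⁅W.D i, z⁆) : L → L → L)) :
    a = 0 := by
  have h3 : (3 : F) ≠ 0 := by
    exact_mod_cast natCast_ne_zero_of_lt F p (k := 3) (by omega) (by omega)
  obtain ⟨g, hg⟩ := h
  ext l
  have := W.ev_sum_sqCochain hp hp5 l a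
  rw [hg, ← dOne_apply, W.ev_dOne_sq hp5] at this
  simpa [h3] using this.symm

end WittFrame

end FrameTheorem

section WittFrameInstance

open MvPolynomial

variable (F : Type*) [Field F] (p n : ℕ)

/-- The class of the monomial `x^a`. -/
def monomialCl (a : Fin n → ℕ) : TruncPoly F p n :=
  Ideal.Quotient.mk _ (monomial (Finsupp.equivFunOnFinite.symm a) 1)

variable {F p n}

lemma monomialCl_eps (i : Fin n) : monomialCl F p n (eps i) = xcl F p n i := by
  have : Finsupp.equivFunOnFinite.symm (eps i) = Finsupp.single i 1 := by
    ext j; simp [Finsupp.single_apply, eq_comm]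
  rw [monomialCl, this]; rfl

lemma monomialCl_zero : monomialCl F p n 0 = 1 := by
  have : Finsupp.equivFunOnFinite.symm (0 : Fin n → ℕ) = 0 := by ext; simp
  rw [monomialCl, this]; rfl

lemma monomialCl_add (a b : Fin n → ℕ) :
    monomialCl F p n (a + b) = monomialCl F p n a * monomialCl F p n b := by
  have : Finsupp.equivFunOnFinite.symm (a + b) =
      Finsupp.equivFunOnFinite.symm a + Finsupp.equivFunOnFinite.symm b := by ext; simp
  rw [monomialCl, monomialCl, monomialCl, ← map_mul, monomial_mul, one_mul, this]

lemma monomialCl_eq_zero {a : Fin n → ℕ} (t : Fin n) (h : p ≤ a t) : monomialCl F p n a = 0 := by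
  have ha : a = p • eps t + (a - p • eps t) := by
    ext s
    by_cases hs : s = t
    · subst hs; simp; omega
    · simp [hs]
  have hp : monomialCl F p n (p • eps t) = 0 := by
    refine Ideal.Quotient.eq_zero_iff_mem.2 (Ideal.subset_span ⟨t, ?_⟩)
    have : Finsupp.equivFunOnFinite.symm (p • eps t) = Finsupp.single t p := by
      ext j; simp [Finsupp.single_apply, eq_comm]
    rw [this]
    simp only [X_pow_eq_monomial]
  rw [ha, monomialCl_add, hp, zero_mul]

lemma span_monomialCl :
    Submodule.span F (Set.range (monomialCl F p n)) = ⊤ := by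
  rw [eq_top_iff]
  rintro f -
  obtain ⟨f, rfl⟩ := Ideal.Quotient.mk_surjective f
  induction f using MvPolynomial.induction_on' with
  | monomial u a =>
    have : Ideal.Quotient.mk (truncIdeal F p n) (monomial u a) = a • monomialCl F p n u := by
      rw [monomialCl, Finsupp.equivFunOnFinite_symm_coe, ← Ideal.Quotient.mkₐ_eq_mk F, ← map_smul,
        smul_monomial, smul_eq_mul, mul_one]
    rw [this]
    exact Submodule.smul_mem _ _ (Submodule.subset_span ⟨_, rfl⟩)
  | add f g hf hg => rw [map_add]; exact Submodule.add_mem _ hf hg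

lemma WittJacobson.ext_xcl {D E : WittJacobson F p n} (h : ∀ i, D (xcl F p n i) = E (xcl F p n i)) :
    D = E := by
  have key : D.compAlgebraMap (MvPolynomial (Fin n) F) = E.compAlgebraMap (MvPolynomial (Fin n) F) :=
    MvPolynomial.derivation_ext fun i => h i
  ext f
  obtain ⟨f, rfl⟩ := Ideal.Quotient.mk_surjective f
  exact DFunLike.congr_fun key f

variable (F n) in
/-- Evaluation at the origin. -/
def evalZero (hp : p ≠ 0) : TruncPoly F p n →ₐ[F] F :=
  Ideal.Quotient.liftₐ (truncIdeal F p n) (MvPolynomial.aeval fun _ => 0) fun f hf => by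
    refine (Ideal.span_le (I := RingHom.ker (MvPolynomial.aeval fun _ => (0 : F)))).2 ?_ hf
    rintro _ ⟨i, rfl⟩
    simp [hp]

lemma evalZero_monomialCl (hp : p ≠ 0) (a : Fin n → ℕ) :
    evalZero F n hp (monomialCl F p n a) = if a = 0 then 1 else 0 := by
  have : evalZero F n hp (monomialCl F p n a) =
      MvPolynomial.aeval (fun _ => (0 : F)) (monomial (Finsupp.equivFunOnFinite.symm a) (1 : F)) :=
    rfl
  rw [this, aeval_monomial, map_one, one_mul, Finsupp.prod_fintype _ _ fun _ => pow_zero _]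
  split_ifs with h
  · simp [h]
  · obtain ⟨i, hi⟩ := Function.ne_iff.1 h
    exact Finset.prod_eq_zero (Finset.mem_univ i) (zero_pow hi)

/-- The value of a derivation at a fixed element. -/
def WittJacobson.applyₗ (f : TruncPoly F p n) : WittJacobson F p n →ₗ[F] TruncPoly F p n where
  toFun D := D f
  map_add' _ _ := rfl
  map_smul' _ _ := rfl

section Frame

variable {Dj : Fin n → WittJacobson F p n}

lemma apply_monomialCl (hDj : ∀ j i, Dj j (xcl F p n i) = if i = j then 1 else 0) (j : Fin n)
    (a : Fin n → ℕ) :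
    Dj j (monomialCl F p n a) = (a j : F) • monomialCl F p n (a - eps j) := by
  have key : (Dj j).compAlgebraMap (MvPolynomial (Fin n) F) =
      (Algebra.linearMap (MvPolynomial (Fin n) F) (TruncPoly F p n)).compDer (pderiv j) :=
    MvPolynomial.derivation_ext fun i => by
      refine (hDj j i).trans ?_
      simp [pderiv_X, Pi.single_apply]
  have hs : Finsupp.equivFunOnFinite.symm (a - eps j) =
      Finsupp.equivFunOnFinite.symm a - Finsupp.single j 1 := by
    ext; simp [Finsupp.single_apply, eq_comm]
  refine (DFunLike.congr_fun key (monomial (Finsupp.equivFunOnFinite.symm a) 1)).trans ?_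
  change Ideal.Quotient.mk _ (pderiv j (monomial _ 1)) = _
  rw [pderiv_monomial, monomialCl, hs, ← Ideal.Quotient.mkₐ_eq_mk F,
    ← map_smul, smul_monomial]
  simp

lemma smul_monomialCl_mul (a b : Fin n → ℕ) (i : Fin n) :
    monomialCl F p n a * ((b i : F) • monomialCl F p n (b - eps i)) =
      (b i : F) • monomialCl F p n (a + b - eps i) := by
  rw [mul_smul_comm, ← monomialCl_add]
  by_cases hb : b i = 0
  · simp [hb]
  · congr 2
    ext t
    by_cases ht : t = i
    · subst ht; simp; omega
    · simp [ht]

/-- The frame `x^a D_i` of `W(n)`. -/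
def wittFrame (hp : p ≠ 0) (hDj : ∀ j i, Dj j (xcl F p n i) = if i = j then 1 else 0) :
    WittFrame F p n (WittJacobson F p n) where
  e a i := monomialCl F p n a • Dj i
  ev k := (evalZero F n hp).toLinearMap ∘ₗ WittJacobson.applyₗ (xcl F p n k)
  X t := Algebra.lsmul F F _ (xcl F p n t)
  R s k := (LinearMap.toSpanSingleton (TruncPoly F p n) _ (Dj k)).restrictScalars F ∘ₗ
    WittJacobson.applyₗ (xcl F p n s)
  span_e := by
    rw [eq_top_iff]
    rintro D -
    have hD : D = ∑ i, D (xcl F p n i) • Dj i := WittJacobson.ext_xcl fun k => by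
      refine ((map_sum (WittJacobson.applyₗ (xcl F p n k)) _ _).trans ?_).symm
      simp [WittJacobson.applyₗ, hDj]
    rw [hD]
    refine Submodule.sum_mem _ fun i _ => ?_
    have hf : D (xcl F p n i) ∈ Submodule.span F (Set.range (monomialCl F p n)) := by
      rw [span_monomialCl]; trivial
    generalize D (xcl F p n i) = f at hf
    induction hf using Submodule.span_induction with
    | mem f hf => obtain ⟨a, rfl⟩ := hf; exact Submodule.subset_span ⟨(a, i), rfl⟩
    | zero => rw [zero_smul (TruncPoly F p n) (Dj i)]; exact Submodule.zero_mem _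
    | add f g _ _ hf hg => rw [add_smul]; exact Submodule.add_mem _ hf hg
    | smul t f _ hf => rw [smul_assoc]; exact Submodule.smul_mem _ t hf
  e_eq_zero a i t h := by rw [monomialCl_eq_zero t h]; exact zero_smul (TruncPoly F p n) (Dj i)
  ev_e k a i := by
    simp only [WittJacobson.applyₗ, LinearMap.comp_apply, LinearMap.coe_mk, AddHom.coe_mk,
      Derivation.smul_apply, hDj, smul_eq_mul, AlgHom.toLinearMap_apply, map_mul,
      evalZero_monomialCl]
    by_cases ha : a = 0 <;> by_cases hk : k = i <;> simp [ha, hk, eq_comm (a := i)]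
  X_e t a i := by
    rw [monomialCl_add, monomialCl_eps, mul_comm]
    exact smul_smul (xcl F p n t) (monomialCl F p n a) (Dj i)
  R_e s k a i := by
    simp only [WittJacobson.applyₗ, LinearMap.comp_apply, LinearMap.coe_mk, AddHom.coe_mk,
      Derivation.smul_apply, hDj, smul_eq_mul, LinearMap.restrictScalars_apply,
      LinearMap.toSpanSingleton_apply, eq_comm (a := s)]
    split_ifs
    · rw [mul_one]
    · rw [mul_zero]; exact zero_smul (TruncPoly F p n) (Dj k)
  lie_e a b i j := WittJacobson.ext_xcl fun k => by
    have h : ∀ (q r : Fin n) (f : TruncPoly F p n), Dj q (f * if k = r then 1 else 0) =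
        Dj q f * if k = r then 1 else 0 := fun q r f => by
      split_ifs <;> simp
    simp only [Derivation.commutator_apply, Derivation.smul_apply, Derivation.sub_apply, hDj,
      smul_eq_mul, h, apply_monomialCl hDj, ← mul_assoc, smul_monomialCl_mul]
    rw [add_comm b a, smul_mul_assoc, smul_mul_assoc]

end Frame

end WittFrameInstance

/-- `H²(W(n), W(n)) = ⊕_{i=1}^n F·Sq(D_i)`. -/
theorem wittJacobson_H2
    (F : Type*) [Field F] [IsAlgClosed F] (p n : ℕ) [CharP F p] (hp : 5 ≤ p)
    (hn : 1 ≤ n)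
    (Dj : Fin n → WittJacobson F p n)
    (hDj : ∀ j i, Dj j (xcl F p n i) = if i = j then 1 else 0) :
    -- each `Sq(D_i)` is a `2`-cocycle
    (∀ i : Fin n, IsLieCocycle2 F (sqCochain F p (fun z : WittJacobson F p n => ⁅Dj i, z⁆))) ∧
    -- the classes `Sq(D_i)` span `H²(W(n), W(n))`
    (∀ c : WittJacobson F p n → WittJacobson F p n → WittJacobson F p n,
      IsLieCocycle2 F c → ∃ a : Fin n → F,
        IsLieCoboundary2 F
          (c - ∑ i : Fin n, a i • sqCochain F p (fun z : WittJacobson F p n => ⁅Dj i, z⁆))) ∧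
    -- the classes `Sq(D_i)` are linearly independent in `H²(W(n), W(n))`
    (∀ a : Fin n → F,
      IsLieCoboundary2 F
        ((∑ i : Fin n, a i • sqCochain F p (fun z : WittJacobson F p n => ⁅Dj i, z⁆) :
          WittJacobson F p n → WittJacobson F p n → WittJacobson F p n)) → a = 0) := by
  have hprime : p.Prime := (CharP.char_is_prime_or_zero F p).resolve_right (by omega)
  obtain ⟨W, hW⟩ : ∃ W : WittFrame F p n (WittJacobson F p n), ∀ j, Dj j = W.D j :=
    ⟨wittFrame (by omega) hDj, fun j => by
      change Dj j = monomialCl F p n 0 • Dj j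
      rw [monomialCl_zero]
      exact (one_smul (TruncPoly F p n) (Dj j)).symm⟩
  simp only [hW]
  exact ⟨fun i => isLieCocycle2_sqCochain_lie hprime hp (W.D i),
    fun c hc => W.exists_isLieCoboundary2_sub hprime hp hc,
    fun a ha => W.eq_zero_of_isLieCoboundary2 hprime hp ha⟩

end
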